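/- For any finite non-degenerate network (V,K), any λ ∈ (0,∞), any admissible ν, and any ε ∈ (0,1/2), the ARW(K,λ,ν) chain satisfies t_sep(ε) − t_sep(1−ε) ≤ √(8 · t_rel · t_sep / ε). -/

import Mathlib

open scoped ENNReal BigOperators
open Filter Asymptotics

namespace ARW

variable {V : Type} [Fintype V] [DecidableEq V]

/-- A sub-stochastic matrix: every row sums to at most `1`. -/
def SubStochastic (K : V → V → ℝ≥0∞) : Prop := ∀ x, ∑ y, K x y ≤ 1

/-- Non-degenerate: no principal sub-matrix of `K` is stochastic. -/
def NonDegenerate (K : V → V → ℝ≥0∞) : Prop :=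
  ∀ S : Finset V, S.Nonempty → ∃ x ∈ S, ∑ y ∈ S, K x y ≠ 1

/-- A probability vector on `V`. -/
def IsProbVec (ν : V → ℝ≥0∞) : Prop := ∑ x, ν x = 1

/-- Probability that the `K`-walk currently at `x` next follows the trajectory `xs`
and is then killed. -/
noncomputable def pathProb (K : V → V → ℝ≥0∞) : V → List V → ℝ≥0∞
  | x, [] => 1 - ∑ y, K x y
  | x, y :: ys => K x y * pathProb K y ys

/-- Probability that a `(K,ν)`-walk has the (finite) full trajectory `w`. -/
noncomputable def walkProb (K : V → V → ℝ≥0∞) (ν : V → ℝ≥0∞) : List V → ℝ≥0∞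
  | [] => 0
  | x :: xs => ν x * pathProb K x xs

/-- `p(x)`: the probability that a `(K,ν)`-walk visits `x` before dying. -/
noncomputable def hitProb (K : V → V → ℝ≥0∞) (ν : V → ℝ≥0∞) (x : V) : ℝ≥0∞ :=
  ∑' w : List V, if x ∈ w then walkProb K ν w else 0

/-- The insertion law `ν` is admissible when every site has a chance of being
visited by a `(K,ν)`-walk. -/
def Admissible (K : V → V → ℝ≥0∞) (ν : V → ℝ≥0∞) : Prop := ∀ x, 0 < hitProb K ν x

/-- The uniform law on `V`. -/
noncomputable def unifLaw (V : Type) [Fintype V] : V → ℝ≥0∞ :=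
  fun _ => (Fintype.card V : ℝ≥0∞)⁻¹

/-! ### IDLA -/

/-- The IDLA update: the walker settles at the first site of its trajectory
which is not already occupied. -/
def idlaUpdate (S : Finset V) : List V → Finset V
  | [] => S
  | x :: xs => if x ∈ S then idlaUpdate S xs else insert x S

/-- The IDLA aggregate obtained from the initial set `A` after using the walks `ws`. -/
def idlaSet (A : Finset V) (ws : List (List V)) : Finset V := ws.foldl idlaUpdate A

/-- `P(T^A > t)`: probability that the IDLA process started from `A` and driven by
i.i.d. `(K,ν)`-walks has not filled `V` after `t` steps. -/
noncomputable def idlaTail (K : V → V → ℝ≥0∞) (ν : V → ℝ≥0∞) (A : Finset V) (t : ℕ) : ℝ≥0∞ :=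
  ∑' ws : Fin t → List V,
    (∏ i, walkProb K ν (ws i)) * (if idlaSet A (List.ofFn ws) = Finset.univ then 0 else 1)

/-- `E[T^A]`: the expected filling time of IDLA started from `A`. -/
noncomputable def idlaMean (K : V → V → ℝ≥0∞) (ν : V → ℝ≥0∞) (A : Finset V) : ℝ≥0∞ :=
  ∑' t : ℕ, idlaTail K ν A t

/-- `Var(T^A)`: the variance of the filling time of IDLA started from `A`. -/
noncomputable def idlaVar (K : V → V → ℝ≥0∞) (ν : V → ℝ≥0∞) (A : Finset V) : ℝ≥0∞ :=
  (∑' t : ℕ, (2 * t + 1) * idlaTail K ν A t) - (idlaMean K ν A) ^ 2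

/-! ### The ARW chain -/

/-- The state of a single site: empty, one sleeping particle, or `n+1` active particles. -/
inductive Site : Type
  | empty : Site
  | sleeping : Site
  | active (n : ℕ) : Site
deriving DecidableEq

/-- A configuration of particles. -/
abbrev Conf (V : Type) := V → Site

def Site.isActive : Site → Bool
  | .active _ => true
  | _ => false

/-- The set of sites holding at least one active particle. -/
def activeSites (η : Conf V) : Finset V := Finset.univ.filter fun x => (η x).isActive

/-- Adding one active particle to a site (waking a sleeping particle if present). -/
def Site.addActive : Site → Site
  | .empty => .active 0
  | .sleeping => .active 1
  | .active n => .active (n + 1)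

/-- Removing one active particle from a site. -/
def Site.removeOne : Site → Site
  | .active (n + 1) => .active n
  | _ => .empty

/-- Adding one active particle at site `y`. -/
def addActiveAt (η : Conf V) (y : V) : Conf V := Function.update η y (η y).addActive

/-- One sequential toppling step of ARW stabilization with sleep rate `lam`:
an active site `x` is selected (if any); if its particle is alone it falls asleep
with probability `lam/(1+lam)`, moves to `y` with probability `K x y/(1+lam)` and
dies with the remaining probability; if it is not alone it moves to `y` with
probability `K x y` and dies with the remaining probability.  Stable
configurations are absorbing. -/
noncomputable def toppleKernel (K : V → V → ℝ≥0∞) (lam : ℝ) (η ξ : Conf V) : ℝ≥0∞ :=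
  if h : (activeSites η).Nonempty then
    let x := h.choose
    let ημ : Conf V := Function.update η x (η x).removeOne
    let move : ℝ≥0∞ := ∑ y, if ξ = addActiveAt ημ y then K x y else 0
    let die : ℝ≥0∞ := if ξ = ημ then 1 - ∑ y, K x y else 0
    if η x = Site.active 0 then
      ((if ξ = Function.update η x Site.sleeping then ENNReal.ofReal lam else 0) + move + die)
        / (ENNReal.ofReal lam + 1)
    else move + die
  else if ξ = η then 1 else 0

/-- Iterates of a sub-probability kernel on configurations. -/
noncomputable def kernelPow (M : Conf V → Conf V → ℝ≥0∞) : ℕ → Conf V → Conf V → ℝ≥0∞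
  | 0 => fun η ξ => if ξ = η then 1 else 0
  | t + 1 => fun η ξ => ∑' σ : Conf V, M η σ * kernelPow M t σ ξ

/-- A stable configuration, seen as a configuration (`true` = sleeping particle). -/
def embed (b : V → Bool) : Conf V := fun x => if b x then Site.sleeping else Site.empty

/-- One step of the `ARW(K,lam,ν)` chain: insert an active particle at a `ν`-distributed
site and stabilize; `arwStep K lam ν η ξ` is the probability of reaching the stable
configuration `ξ` from the stable configuration `η`. -/
noncomputable def arwStep (K : V → V → ℝ≥0∞) (lam : ℝ) (ν : V → ℝ≥0∞)
    (η ξ : V → Bool) : ℝ≥0∞ :=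
  ∑ x, ν x * ⨆ t, kernelPow (toppleKernel K lam) t (addActiveAt (embed η) x) (embed ξ)

/-- The transition matrix of the `ARW(K,lam,ν)` chain on stable configurations. -/
noncomputable def arwMatrix (K : V → V → ℝ≥0∞) (lam : ℝ) (ν : V → ℝ≥0∞) :
    Matrix (V → Bool) (V → Bool) ℝ :=
  Matrix.of fun η ξ => (arwStep K lam ν η ξ).toReal

/-! ### Distances to equilibrium, mixing and relaxation times -/

variable {S : Type} [Fintype S] [DecidableEq S]

/-- `π` is a stationary probability distribution for `P`. -/
def IsStationary (P : Matrix S S ℝ) (π : S → ℝ) : Prop :=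
  (∀ s, 0 ≤ π s) ∧ (∑ s, π s = 1) ∧ ∀ s, ∑ r, π r * P r s = π s

/-- The separation distance to equilibrium at time `t`. -/
noncomputable def sepDist (P : Matrix S S ℝ) (π : S → ℝ) (t : ℕ) : ℝ :=
  ⨆ η, ⨆ ξ, (1 - (P ^ t) η ξ / π ξ)

/-- The separation mixing time with precision `ε`. -/
noncomputable def sepMix (P : Matrix S S ℝ) (π : S → ℝ) (ε : ℝ) : ℕ :=
  sInf {t : ℕ | sepDist P π t ≤ ε}

/-- The total-variation distance to equilibrium at time `t`. -/
noncomputable def tvDist (P : Matrix S S ℝ) (π : S → ℝ) (t : ℕ) : ℝ :=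
  ⨆ η, ⨆ A : Finset S, |∑ ξ ∈ A, ((P ^ t) η ξ - π ξ)|

/-- The total-variation mixing time with precision `ε`. -/
noncomputable def tvMix (P : Matrix S S ℝ) (π : S → ℝ) (ε : ℝ) : ℕ :=
  sInf {t : ℕ | tvDist P π t ≤ ε}

/-- The relaxation time `1/(1-ρ)`, where `ρ` is the largest modulus of the
(complex) eigenvalues of `P` other than `1`. -/
noncomputable def relTime (P : Matrix S S ℝ) : ℝ :=
  (1 - sSup {r : ℝ | ∃ z : ℂ,
      z ≠ 1 ∧ (P.map (fun a : ℝ => (a : ℂ))).charpoly.IsRoot z ∧ r = ‖z‖})⁻¹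

/-- Separation (or total-variation) cutoff for a sequence of chains with distance
functions `d n` and mixing times `ts n`. -/
def HasCutoff (d : ℕ → ℕ → ℝ) (ts : ℕ → ℕ) : Prop :=
  ∀ α : ℝ, 0 ≤ α →
    (α < 1 → Tendsto (fun n => d n ⌊α * (ts n : ℝ)⌋₊) atTop (nhds 1)) ∧
    (1 < α → Tendsto (fun n => d n ⌊α * (ts n : ℝ)⌋₊) atTop (nhds 0))

end ARW

namespace ARW
open Finset

section maps
variable {V : Type} [Fintype V] [DecidableEq V]

noncomputable def qd (p : (Finset V → Finset V) → ℝ) : ℕ → Finset V → ℝ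
  | 0, A => if A = univ then 0 else 1
  | t + 1, A => ∑ g, p g * qd p t (g A)

noncomputable def pz (p : (Finset V → Finset V) → ℝ) (z : V) : ℝ :=
  ∑ g, if g (univ.erase z) = univ then p g else 0

structure Good (p : (Finset V → Finset V) → ℝ) : Prop where
  nonneg : ∀ g, 0 ≤ p g
  sum_one : ∑ g, p g = 1
  mono : ∀ g, p g ≠ 0 → Monotone g
  ext : ∀ g, p g ≠ 0 → ∀ A, A ⊆ g A
  ins : ∀ g, p g ≠ 0 → ∀ A x, ∃ z, g (insert x A) = insert z (g A)
  step : ∀ g, p g ≠ 0 → ∀ A, g A = A ∨ ∃ z, g A = insert z A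

variable {p : (Finset V → Finset V) → ℝ}

lemma Good.avg_le (hp : Good p) {F G : (Finset V → Finset V) → ℝ}
    (h : ∀ g, p g ≠ 0 → F g ≤ G g) : ∑ g, p g * F g ≤ ∑ g, p g * G g := by
  refine sum_le_sum fun g _ => ?_
  by_cases h0 : p g = 0
  · simp [h0]
  · exact mul_le_mul_of_nonneg_left (h g h0) (hp.nonneg g)

lemma Good.avg_const (hp : Good p) (a : ℝ) : ∑ g, p g * a = a := by
  rw [← sum_mul, hp.sum_one, one_mul]

lemma Good.avg_congr {F G : (Finset V → Finset V) → ℝ}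
    (h : ∀ g, p g ≠ 0 → F g = G g) : ∑ g, p g * F g = ∑ g, p g * G g := by
  refine sum_congr rfl fun g _ => ?_
  by_cases h0 : p g = 0
  · simp [h0]
  · rw [h g h0]

lemma Good.univ' (hp : Good p) {g : Finset V → Finset V} (h : p g ≠ 0) : g univ = univ :=
  univ_subset_iff.1 (hp.ext g h univ)

lemma qd_nonneg (hp : Good p) (t : ℕ) (A : Finset V) : 0 ≤ qd p t A := by
  induction t generalizing A with
  | zero => simp only [qd]; split_ifs <;> norm_num
  | succ t ih => exact sum_nonneg fun g _ => mul_nonneg (hp.nonneg g) (ih _)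

lemma qd_le_one (hp : Good p) (t : ℕ) (A : Finset V) : qd p t A ≤ 1 := by
  induction t generalizing A with
  | zero => simp only [qd]; split_ifs <;> norm_num
  | succ t ih =>
    refine (hp.avg_le (G := fun _ => 1) fun g _ => ih _).trans (hp.avg_const 1).le

lemma qd_univ (hp : Good p) (t : ℕ) : qd p t univ = 0 := by
  induction t with
  | zero => simp [qd]
  | succ t ih =>
    simp only [qd]
    rw [Good.avg_congr (G := fun _ => 0)]
    · simp
    · intro g hg; rw [hp.univ' hg, ih]

lemma qd_anti (hp : Good p) (t : ℕ) {A B : Finset V} (h : A ⊆ B) : qd p t B ≤ qd p t A := by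
  induction t generalizing A B with
  | zero =>
    simp only [qd]
    split_ifs with h1 h2 h2
    · norm_num
    · norm_num
    · subst h2; exact absurd (univ_subset_iff.1 h) h1
    · norm_num
  | succ t ih => exact hp.avg_le fun g hg => ih (hp.mono g hg h)

lemma qd_succ_le (hp : Good p) (t : ℕ) (A : Finset V) : qd p (t+1) A ≤ qd p t A := by
  refine (hp.avg_le (G := fun _ => qd p t A) fun g hg => qd_anti hp t (hp.ext g hg A)).trans
    (hp.avg_const _).le

lemma qd_antitone (hp : Good p) (A : Finset V) : Antitone fun t => qd p t A :=
  antitone_nat_of_succ_le fun t => qd_succ_le hp t A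

lemma qd_submul (hp : Good p) (s t : ℕ) (A : Finset V) :
    qd p (t + s) A ≤ qd p t A * qd p s ∅ := by
  induction t generalizing A with
  | zero =>
    by_cases h : A = univ
    · subst h; simp [qd_univ hp]
    · simp only [zero_add]
      have : qd p 0 A = 1 := by simp [qd, h]
      rw [this, one_mul]; exact qd_anti hp s (empty_subset _)
  | succ t ih =>
    rw [show t + 1 + s = (t + s) + 1 by ring]
    simp only [qd]
    rw [sum_mul]
    simp only [mul_assoc]
    exact hp.avg_le fun g _ => ih _

noncomputable def Qd (p : (Finset V → Finset V) → ℝ) (t : ℕ) (A : Finset V) : ℝ :=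
  ∑ i ∈ range t, qd p i A

lemma Qd_succ (t : ℕ) (A : Finset V) :
    Qd p (t+1) A = qd p 0 A + ∑ g, p g * Qd p t (g A) := by
  simp only [Qd, sum_range_succ', qd, mul_sum]
  rw [sum_comm, add_comm]

lemma Qd_univ (hp : Good p) (t : ℕ) : Qd p t univ = 0 := by
  simp [Qd, qd_univ hp]

lemma Qd_anti (hp : Good p) (t : ℕ) {A B : Finset V} (h : A ⊆ B) : Qd p t B ≤ Qd p t A :=
  sum_le_sum fun i _ => qd_anti hp i h

lemma Qd_mono (hp : Good p) (A : Finset V) : Monotone fun t => Qd p t A :=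
  monotone_nat_of_le_succ fun t => by
    simp only [Qd, sum_range_succ]; linarith [qd_nonneg hp t A]

lemma Qd_nonneg (hp : Good p) (t : ℕ) (A : Finset V) : 0 ≤ Qd p t A :=
  sum_nonneg fun i _ => qd_nonneg hp i A

lemma avg_erase (hp : Good p) (z : V) (F : Finset V → ℝ) (hF : F univ = 0) :
    ∑ g, p g * F (g (univ.erase z)) = (1 - pz p z) * F (univ.erase z) := by
  rw [← hp.sum_one, pz, ← sum_sub_distrib, sum_mul]
  refine sum_congr rfl fun g _ => ?_
  by_cases h0 : p g = 0
  · simp [h0]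
  split_ifs with h
  · simp [h, hF]
  · have : g (univ.erase z) = univ.erase z := by
      have h1 := hp.ext g h0 (univ.erase z)
      refine (subset_antisymm h1 ?_).symm
      intro y hy
      rw [mem_erase]
      refine ⟨?_, mem_univ _⟩
      rintro rfl
      apply h
      ext x
      simp only [mem_univ, iff_true]
      by_cases hx : x = y
      · exact hx ▸ hy
      · exact h1 (by simp [hx])
    simp [this]

lemma qd_erase (hp : Good p) (z : V) (t : ℕ) : qd p t (univ.erase z) = (1 - pz p z) ^ t := by
  induction t with
  | zero =>
    simp only [qd, pow_zero]
    rw [if_neg]; intro h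
    have := mem_univ z; rw [← h] at this; simp at this
  | succ t ih =>
    simp only [qd]
    rw [avg_erase hp z (qd p t) (qd_univ hp t), ih, pow_succ]; ring

lemma pz_le_one (hp : Good p) (z : V) : pz p z ≤ 1 := by
  have := qd_nonneg hp 1 (univ.erase z)
  rw [qd_erase hp] at this; linarith [this, pow_one (1 - pz p z)]

lemma Qd_diff (hp : Good p) {c : ℝ} (hc : 0 ≤ c) (hcz : ∀ z, 1 ≤ pz p z * c) (t : ℕ)
    (A : Finset V) (x : V) : Qd p t A - Qd p t (insert x A) ≤ c := by
  induction t generalizing A x with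
  | zero => simpa [Qd] using hc
  | succ t ih =>
    by_cases hx : x ∈ A
    · rw [insert_eq_of_mem hx]; simpa using hc
    by_cases hB : insert x A = univ
    · have hA : A = univ.erase x := by rw [← hB, erase_insert hx]
      rw [hB, Qd_univ hp, Qd_succ, hA, avg_erase hp x (Qd p t) (Qd_univ hp t)]
      have h1 := ih (univ.erase x) x
      rw [insert_erase (mem_univ _), Qd_univ hp] at h1
      have h0 : qd p 0 (univ.erase x) = 1 := by rw [qd_erase hp]; simp
      rw [h0]
      have := pz_le_one hp x
      nlinarith [hcz x]
    · have hA : A ≠ univ := by rintro rfl; simp at hx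
      rw [Qd_succ, Qd_succ]
      have h1 : qd p 0 A = 1 := by simp [qd, hA]
      have h2 : qd p 0 (insert x A) = 1 := by simp [qd, hB]
      rw [h1, h2, add_sub_add_left_eq_sub, ← sum_sub_distrib]
      simp only [← mul_sub]
      refine (hp.avg_le (G := fun _ => c) fun g hg => ?_).trans (hp.avg_const _).le
      obtain ⟨z, hz⟩ := hp.ins g hg A x
      rw [hz]; exact ih _ _

lemma Qd_bdd (hp : Good p) {c : ℝ} (hc : 0 ≤ c) (hcz : ∀ z, 1 ≤ pz p z * c) (t : ℕ)
    (A : Finset V) : Qd p t A ≤ c * Fintype.card V := by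
  have key : ∀ B : Finset V, Qd p t ∅ - Qd p t B ≤ c * B.card := by
    intro B
    induction B using Finset.induction_on with
    | empty => simp
    | insert x B hx ih =>
      rw [card_insert_of_notMem hx]; push_cast
      linarith [Qd_diff hp hc hcz t B x]
  have h := key univ
  rw [Qd_univ hp, card_univ] at h
  linarith [Qd_anti hp t (empty_subset A)]

lemma qd_tendsto (hp : Good p) {c : ℝ} (hc : 0 ≤ c) (hcz : ∀ z, 1 ≤ pz p z * c)
    (A : Finset V) : Tendsto (fun t => qd p t A) atTop (nhds 0) := by
  have hs : Summable fun t => qd p t A :=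
    summable_of_sum_range_le (fun t => qd_nonneg hp t A) (fun t => Qd_bdd hp hc hcz t A)
  exact hs.tendsto_atTop_zero

lemma Qd_le_two (hp : Good p) {N : ℕ} (hN : qd p N ∅ ≤ 1 / 2) (t : ℕ) : Qd p t ∅ ≤ 2 * N := by
  have h1 : Qd p t ∅ ≤ Qd p (N + t) ∅ := Qd_mono hp ∅ (Nat.le_add_left _ _)
  have h2 : Qd p (N + t) ∅ = Qd p N ∅ + ∑ i ∈ range t, qd p (N + i) ∅ := by
    simp only [Qd, sum_range_add]
  have h3 : Qd p N ∅ ≤ N := by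
    refine (sum_le_sum (g := fun _ => (1:ℝ)) fun i _ => qd_le_one hp i ∅).trans ?_
    simp
  have h4 : ∑ i ∈ range t, qd p (N + i) ∅ ≤ 1 / 2 * Qd p t ∅ := by
    rw [Qd, mul_sum]
    refine sum_le_sum fun i _ => ?_
    refine (qd_submul hp i N ∅).trans ?_
    exact mul_le_mul_of_nonneg_right hN (qd_nonneg hp _ _)
  linarith

/-- expected filling time -/
lemma exists_mean (hp : Good p) {c : ℝ} (hc : 0 ≤ c) (hcz : ∀ z, 1 ≤ pz p z * c)
    {N : ℕ} (hN : qd p N ∅ ≤ 1 / 2) :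
    ∃ f : Finset V → ℝ, f univ = 0 ∧ (∀ A, A ≠ univ → f A = 1 + ∑ g, p g * f (g A)) ∧
      (∀ A t, Qd p t A ≤ f A) ∧ f ∅ ≤ 2 * N ∧ (∀ A x, f A - f (insert x A) ≤ c) ∧
      (∀ A B, A ⊆ B → f B ≤ f A) := by
  have hb : ∀ A, BddAbove (Set.range fun t => Qd p t A) := fun A =>
    ⟨_, by rintro _ ⟨t, rfl⟩; exact Qd_bdd hp hc hcz t A⟩
  have ht : ∀ A, Tendsto (fun t => Qd p t A) atTop (nhds (⨆ t, Qd p t A)) := fun A =>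
    tendsto_atTop_ciSup (Qd_mono hp A) (hb A)
  refine ⟨fun A => ⨆ t, Qd p t A, ?_, ?_, ?_, ?_, ?_, ?_⟩
  · simp [Qd_univ hp]
  · intro A hA
    have h1 := (tendsto_add_atTop_iff_nat 1).2 (ht A)
    have h2 : Tendsto (fun t => Qd p (t+1) A) atTop
        (nhds (1 + ∑ g, p g * ⨆ t, Qd p t (g A))) := by
      simp only [Qd_succ]
      have : qd p 0 A = 1 := by simp [qd, hA]
      rw [this]
      exact tendsto_const_nhds.add (tendsto_finsetSum _ fun g _ => (ht _).const_mul _)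
    exact tendsto_nhds_unique h1 h2
  · intro A t; exact le_ciSup (hb A) t
  · exact ciSup_le fun t => Qd_le_two hp hN t
  · intro A x
    exact le_of_tendsto ((ht A).sub (ht (insert x A)))
      (Eventually.of_forall fun t => Qd_diff hp hc hcz t A x)
  · intro A B h
    exact le_of_tendsto_of_tendsto' (ht B) (ht A) fun t => Qd_anti hp t h

noncomputable def Dd (p : (Finset V → Finset V) → ℝ) (f : Finset V → ℝ) :
    ℕ → Finset V → ℝ → ℝ
  | 0, A, s => (s + f A) ^ 2
  | t + 1, A, s => if A = univ then s ^ 2 else ∑ g, p g * Dd p f t (g A) (s + 1)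

lemma Dd_upper (hp : Good p) {c : ℝ} (hc : 0 ≤ c) {f : Finset V → ℝ} (f0 : f univ = 0)
    (f1 : ∀ A, A ≠ univ → f A = 1 + ∑ g, p g * f (g A))
    (f2 : ∀ A x, f A - f (insert x A) ≤ c) (f3 : ∀ A B, A ⊆ B → f B ≤ f A)
    (t : ℕ) (A : Finset V) (s : ℝ) :
    Dd p f t A s ≤ (s + f A) ^ 2 + c * Qd p t A := by
  induction t generalizing A s with
  | zero => simp [Dd, Qd]
  | succ t ih =>
    simp only [Dd]
    split_ifs with hA
    · subst hA; rw [f0, Qd_univ hp]; simp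
    · have h0 : qd p 0 A = 1 := by simp [qd, hA]
      rw [Qd_succ, h0]
      have e1 : ∑ g, p g * Dd p f t (g A) (s + 1) ≤
          ∑ g, p g * ((s + f A)^2 + 2 * (s + f A) * (1 + f (g A) - f A) +
            c * (f A - f (g A)) - 2 * (f A - f (g A)) + 1 + c * Qd p t (g A)) := by
        refine hp.avg_le fun g hg => (ih _ _).trans ?_
        have hd0 : 0 ≤ f A - f (g A) := sub_nonneg.2 (f3 _ _ (hp.ext g hg A))
        have hd1 : f A - f (g A) ≤ c := by
          rcases hp.step g hg A with h | ⟨z, h⟩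
          · rw [h]; simpa using hc
          · rw [h]; exact f2 A z
        nlinarith [mul_nonneg hd0 (sub_nonneg.2 hd1)]
      have e2 : ∑ g, p g * ((s + f A)^2 + 2 * (s + f A) * (1 + f (g A) - f A) +
            c * (f A - f (g A)) - 2 * (f A - f (g A)) + 1 + c * Qd p t (g A)) =
          ((s + f A)^2 + 2 * (s + f A) * (1 - f A) + c * f A - 2 * f A + 1) * ∑ g, p g
            + (2 * (s + f A) - c + 2) * ∑ g, p g * f (g A)
            + c * ∑ g, p g * Qd p t (g A) := by
        simp only [mul_sum, ← sum_add_distrib]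
        exact sum_congr rfl fun g _ => by ring
      rw [e2, hp.sum_one] at e1
      have e3 : ∑ g, p g * f (g A) = f A - 1 := by rw [f1 A hA]; ring
      rw [e3] at e1
      nlinarith

lemma Dd_lower1 (hp : Good p) {f : Finset V → ℝ} (f1 : ∀ A, A ≠ univ → 1 ≤ f A)
    (t : ℕ) (A : Finset V) (s : ℝ) (hs : 0 ≤ s + t + 1) :
    qd p t A * (s + t + 1) ^ 2 ≤ Dd p f t A s := by
  induction t generalizing A s with
  | zero =>
    simp only [qd, Dd]
    split_ifs with hA
    · simp; positivity
    · have := f1 A hA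
      push_cast at *
      nlinarith
  | succ t ih =>
    simp only [Dd]
    split_ifs with hA
    · subst hA; rw [qd_univ hp]; simp; positivity
    · simp only [qd]
      rw [sum_mul]; simp only [mul_assoc]
      refine hp.avg_le fun g _ => ?_
      have := ih (g A) (s + 1) (by push_cast at hs; linarith)
      push_cast
      convert this using 3; ring

lemma Dd_lower2 (hp : Good p) {f : Finset V → ℝ} (f0 : f univ = 0)
    (t : ℕ) (A : Finset V) (s : ℝ) (hs : s + t ≤ 0) :
    (1 - qd p t A) * (s + t) ^ 2 ≤ Dd p f t A s := by
  induction t generalizing A s with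
  | zero =>
    simp only [qd, Dd]
    split_ifs with hA
    · simp [hA, f0]
    · simp; positivity
  | succ t ih =>
    simp only [Dd]
    split_ifs with hA
    · subst hA; rw [qd_univ hp]
      push_cast at *
      have : (0:ℝ) ≤ t := Nat.cast_nonneg t
      nlinarith
    · simp only [qd]
      have : (1 - ∑ g, p g * qd p t (g A)) = ∑ g, p g * (1 - qd p t (g A)) := by
        simp only [mul_sub, mul_one, sum_sub_distrib, hp.sum_one]
      rw [this, sum_mul]; simp only [mul_assoc]
      refine hp.avg_le fun g _ => ?_
      have := ih (g A) (s + 1) (by push_cast at hs; linarith)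
      push_cast
      convert this using 3; ring

/-- The window estimate. -/
lemma window (hp : Good p) {c : ℝ} (hc : 0 ≤ c) (hcz : ∀ z, 1 ≤ pz p z * c)
    {N a b : ℕ} (hN : qd p N ∅ ≤ 1 / 2) {ε : ℝ} (hε : 0 < ε)
    (ha : qd p a ∅ ≤ 1 - ε) (hb : b = 0 ∨ ε < qd p (b - 1) ∅) :
    (b : ℝ) - a ≤ Real.sqrt (8 * c * N / ε) := by
  rcases hb with rfl | hb
  · have : (0:ℝ) ≤ a := Nat.cast_nonneg a
    have := Real.sqrt_nonneg (8 * c * N / ε)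
    push_cast; linarith
  rcases Nat.eq_zero_or_pos b with rfl | hbpos
  · have : (0:ℝ) ≤ a := Nat.cast_nonneg a
    have := Real.sqrt_nonneg (8 * c * N / ε)
    push_cast; linarith
  obtain ⟨f, f0, f1, f2, f3, f4, f5⟩ := exists_mean hp hc hcz hN
  have f6 : ∀ A, A ≠ univ → 1 ≤ f A := fun A hA => by
    have := f2 A 1
    simpa [Qd, qd, hA] using this
  set m := f ∅ with hm
  have hm0 : 0 ≤ m := by simpa [Qd] using f2 ∅ 0
  set v := c * m with hv
  have hv0 : 0 ≤ v := mul_nonneg hc hm0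
  have up : ∀ t, Dd p f t ∅ (-m) ≤ v := fun t => by
    have := Dd_upper hp hc f0 f1 f4 f5 t ∅ (-m)
    have h2 := mul_le_mul_of_nonneg_left (f2 ∅ t) hc
    rw [← hm] at this h2
    simp at this
    linarith
  have hw : Real.sqrt (8 * c * N / ε) ≥ 2 * Real.sqrt (v / ε) := by
    have : 2 * Real.sqrt (v / ε) = Real.sqrt (4 * (v / ε)) := by
      rw [Real.sqrt_mul (by norm_num), show (4:ℝ) = 2 ^ 2 by norm_num, Real.sqrt_sq (by norm_num)]
    rw [this]
    apply Real.sqrt_le_sqrt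
    rw [← mul_div_assoc]
    apply div_le_div_of_nonneg_right _ hε.le
    rw [hv]; nlinarith [mul_le_mul_of_nonneg_left f3 hc]
  have h1 : (b : ℝ) - m ≤ Real.sqrt (v / ε) := by
    rcases le_total ((b:ℝ) - m) 0 with h | h
    · exact h.trans (Real.sqrt_nonneg _)
    · apply Real.le_sqrt_of_sq_le
      rw [le_div_iff₀ hε]
      have e : ((b - 1 : ℕ) : ℝ) = b - 1 := by push_cast [Nat.cast_sub hbpos]; ring
      have := (Dd_lower1 hp f6 (b-1) ∅ (-m) (by rw [e]; linarith)).trans (up _)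
      rw [e] at this
      have h3 : (-m + (b - 1) + 1 : ℝ) = b - m := by ring
      rw [h3] at this
      nlinarith [mul_le_mul_of_nonneg_right hb.le (sq_nonneg ((b:ℝ) - m))]
  have h2 : m - a ≤ Real.sqrt (v / ε) := by
    rcases le_total (m - a) 0 with h | h
    · exact h.trans (Real.sqrt_nonneg _)
    · apply Real.le_sqrt_of_sq_le
      rw [le_div_iff₀ hε]
      have := (Dd_lower2 hp f0 a ∅ (-m) (by linarith)).trans (up _)
      nlinarith [mul_le_mul_of_nonneg_right (show ε ≤ 1 - qd p a ∅ by linarith)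
        (sq_nonneg (-m + (a:ℝ)))]
  linarith

end maps
end ARW

namespace ARW
open Finset

section spec
variable {S : Type} [Fintype S] [DecidableEq S]

open scoped Matrix.Norms.Operator in
lemma gelfand_lower [Nonempty S] (Q : Matrix S S ℂ) {r a : ℝ} (hr : 0 < r) (ha : 0 < a) (i j : S)
    (h : ∀ n : ℕ, 0 < n → r ^ n * a ≤ ‖(Q ^ n) i j‖) : ∃ z ∈ spectrum ℂ Q, r ≤ ‖z‖ := by
  obtain ⟨z, hz, hz2⟩ := spectrum.exists_nnnorm_eq_spectralRadius Q
  refine ⟨z, hz, ?_⟩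
  have hg := spectrum.pow_norm_pow_one_div_tendsto_nhds_spectralRadius Q
  rw [← hz2] at hg
  have h1 : ∀ n : ℕ, 0 < n → r ^ n * a ≤ ‖Q ^ n‖ := fun n hn => by
    refine (h n hn).trans ?_
    rw [← coe_nnnorm, ← coe_nnnorm, NNReal.coe_le_coe, Matrix.linfty_opNNNorm_def]
    refine le_trans ?_ (Finset.le_sup (f := fun i => ∑ j, ‖(Q ^ n) i j‖₊) (mem_univ i))
    exact Finset.single_le_sum (f := fun j => ‖(Q ^ n) i j‖₊) (fun _ _ => zero_le) (mem_univ j)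
  have h2 : Tendsto (fun n : ℕ => ENNReal.ofReal (r * a ^ (1 / n : ℝ))) atTop
      (nhds (ENNReal.ofReal (r * a ^ (0:ℝ)))) := by
    apply ENNReal.tendsto_ofReal
    apply Tendsto.const_mul
    exact (tendsto_const_nhds).rpow tendsto_one_div_atTop_nhds_zero_nat (Or.inl ha.ne')
  have h3 : ENNReal.ofReal (r * a ^ (0:ℝ)) ≤ (‖z‖₊ : ℝ≥0∞) := by
    refine le_of_tendsto_of_tendsto h2 hg ?_
    filter_upwards [eventually_gt_atTop 0] with n hn
    apply ENNReal.ofReal_le_ofReal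
    have hn' : (n:ℝ) ≠ 0 := by positivity
    calc r * a ^ (1 / n : ℝ) = (r ^ n * a) ^ (1 / n : ℝ) := by
          rw [Real.mul_rpow (by positivity) ha.le, ← Real.rpow_natCast, ← Real.rpow_mul hr.le]
          rw [mul_one_div_cancel hn', Real.rpow_one]
      _ ≤ _ := Real.rpow_le_rpow (by positivity) (h1 n hn) (by positivity)
  rw [Real.rpow_zero, mul_one, ← enorm_eq_nnnorm, ← ofReal_norm] at h3
  exact (ENNReal.ofReal_le_ofReal_iff (norm_nonneg _)).1 h3

lemma spectral [Nonempty S] (P : Matrix S S ℝ) (π : S → ℝ) (hrow : ∀ s, ∑ r, P s r = 1)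
    (hst : IsStationary P π) (q : ℕ → ℝ) (hq : Tendsto q atTop (nhds 0))
    (hlow : ∀ t η ξ, (1 - q t) * π ξ ≤ (P ^ t) η ξ) (η0 ξ0 : S) (hpos : 0 < π ξ0)
    (r : ℝ) (hr : 0 ≤ r) (h : ∀ t : ℕ, r ^ t * π ξ0 ≤ π ξ0 - (P ^ t) η0 ξ0) :
    ∃ ρ, relTime P = (1 - ρ)⁻¹ ∧ r ≤ ρ ∧ ρ < 1 := by
  refine ⟨_, rfl, ?_⟩
  obtain ⟨hπ0, hπ1, hπP⟩ := hst
  set Pc : Matrix S S ℂ := P.map (fun a : ℝ => (a : ℂ)) with hPc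
  have hPow : ∀ (t : ℕ) i j, (Pc ^ t) i j = (((P ^ t) i j : ℝ) : ℂ) := by
    intro t i j
    have h1 : Pc = Complex.ofRealHom.mapMatrix P := rfl
    rw [h1, ← map_pow]; rfl
  have hrowt : ∀ (t : ℕ) s, ∑ r, (P ^ t) s r = 1 := by
    intro t
    induction t with
    | zero => intro s; simp [Matrix.one_apply]
    | succ t ih =>
      intro s
      simp only [pow_succ, Matrix.mul_apply]
      rw [sum_comm]
      simp only [← mul_sum, hrow, mul_one, ih]
  have hlim : ∀ i j, Tendsto (fun t => (P ^ t) i j) atTop (nhds (π j)) := by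
    intro i j
    have l1 : Tendsto (fun t => (1 - q t) * π j) atTop (nhds (π j)) := by
      simpa using (hq.const_sub 1).mul_const (π j)
    have l2 : Tendsto (fun t => 1 - (1 - q t) * (1 - π j)) atTop (nhds (π j)) := by
      simpa using ((hq.const_sub 1).mul_const (1 - π j)).const_sub 1
    refine tendsto_of_tendsto_of_tendsto_of_le_of_le l1 l2 (fun t => hlow t i j) (fun t => ?_)
    have e1 := hrowt t i
    rw [← add_sum_erase _ _ (mem_univ j)] at e1 hπ1
    have e2 : ∑ x ∈ univ.erase j, (1 - q t) * π x ≤ ∑ x ∈ univ.erase j, (P ^ t) i x :=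
      sum_le_sum fun x _ => hlow t i x
    rw [← mul_sum] at e2
    have e3 : ∑ x ∈ univ.erase j, π x = 1 - π j := by linarith
    rw [e3] at e2
    show (P ^ t) i j ≤ _
    linarith
  have heig : ∀ (z : ℂ) (v : S → ℂ), Pc.mulVec v = z • v → ∀ (t : ℕ) s,
      ∑ j, (((P ^ t) s j : ℝ) : ℂ) * v j = z ^ t * v s := by
    intro z v hv t s
    have : (Pc ^ t).mulVec v = z ^ t • v := by
      induction t with
      | zero => simp
      | succ t ih => rw [pow_succ, ← Matrix.mulVec_mulVec, hv, Matrix.mulVec_smul, ih, smul_smul,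
          pow_succ, mul_comm]
    have := congrFun this s
    simpa [Matrix.mulVec, dotProduct, hPow] using this
  have heiglim : ∀ (z : ℂ) (v : S → ℂ), Pc.mulVec v = z • v → ∀ s,
      Tendsto (fun t : ℕ => z ^ t * v s) atTop (nhds (∑ j, (π j : ℂ) * v j)) := by
    intro z v hv s
    simp only [← heig z v hv]
    refine tendsto_finsetSum _ fun j _ => Tendsto.mul_const _ ?_
    exact (Complex.continuous_ofReal.tendsto _).comp (hlim s j)
  set Z := {r : ℝ | ∃ z : ℂ, z ≠ 1 ∧ Pc.charpoly.IsRoot z ∧ r = ‖z‖} with hZ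
  have hZfin : Z.Finite := by
    refine ((Pc.charpoly.roots.toFinset.finite_toSet).image (fun z : ℂ => ‖z‖)).subset ?_
    rintro _ ⟨z, -, hz, rfl⟩
    refine ⟨z, ?_, rfl⟩
    simp only [Multiset.mem_toFinset, Finset.mem_coe]
    exact (Polynomial.mem_roots (Matrix.charpoly_monic _).ne_zero).2 hz
  have hZlt : ∀ x ∈ Z, x < 1 := by
    rintro _ ⟨z, hz1, hz, rfl⟩
    rw [Polynomial.IsRoot.def, Matrix.eval_charpoly, ← Matrix.exists_mulVec_eq_zero_iff] at hz
    obtain ⟨v, hv0, hv⟩ := hz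
    have hv' : Pc.mulVec v = z • v := by
      rw [Matrix.sub_mulVec, sub_eq_zero] at hv
      rw [← hv, Matrix.scalar_apply]
      ext s; simp [Matrix.mulVec_diagonal]
    obtain ⟨s, hs⟩ := Function.ne_iff.1 hv0
    have h1 := heiglim z v hv' s
    set L := ∑ j, (π j : ℂ) * v j
    have h2 := h1.const_mul z
    have h3 := (tendsto_add_atTop_iff_nat 1).2 h1
    have h4 : z * L = L := by
      refine tendsto_nhds_unique h2 (h3.congr fun t => ?_)
      rw [pow_succ]; ring
    have hL : L = 0 := by
      have : (z - 1) * L = 0 := by rw [sub_mul, h4]; ring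
      rcases mul_eq_zero.1 this with h | h
      · exact absurd (sub_eq_zero.1 h) hz1
      · exact h
    rw [hL] at h1
    have h5 := h1.mul_const (v s)⁻¹
    rw [zero_mul] at h5
    have h6 : Tendsto (fun t : ℕ => z ^ t) atTop (nhds 0) := by
      refine h5.congr fun t => ?_
      have : v s ≠ 0 := hs
      field_simp
    exact tendsto_pow_atTop_nhds_zero_iff_norm_lt_one.1 h6
  have hZ0 : 0 ≤ sSup Z := Real.sSup_nonneg (by rintro _ ⟨z, -, -, rfl⟩; exact norm_nonneg _)
  refine ⟨?_, ?_⟩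
  · rcases hr.eq_or_lt with rfl | hr
    · exact hZ0
    let Pi : Matrix S S ℂ := Matrix.of fun _ j => (π j : ℂ)
    have hsumC : ∑ j, (π j : ℂ) = 1 := by exact_mod_cast hπ1
    have m1 : Pc * Pi = Pi := by
      ext i j
      simp only [Matrix.mul_apply, Pi, Matrix.of_apply, ← sum_mul]
      have : ∑ x, Pc i x = 1 := by
        simp only [hPc, Matrix.map_apply]; exact_mod_cast hrow i
      rw [this, one_mul]
    have m2 : Pi * Pc = Pi := by
      ext i j
      simp only [Matrix.mul_apply, Pi, Matrix.of_apply, hPc, Matrix.map_apply]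
      exact_mod_cast hπP j
    have m3 : Pi * Pi = Pi := by
      ext i j
      simp only [Matrix.mul_apply, Pi, Matrix.of_apply, ← sum_mul, hsumC, one_mul]
    have hQ : ∀ t : ℕ, (Pc - Pi) ^ (t + 1) = Pc ^ (t + 1) - Pi := by
      intro t
      induction t with
      | zero => simp
      | succ t ih =>
        have m4 : Pc ^ (t + 1) * Pi = Pi := by
          clear ih
          induction t with
          | zero => simpa using m1
          | succ t ih => rw [pow_succ, mul_assoc, m1, ih]
        rw [pow_succ, ih, sub_mul, mul_sub, mul_sub, m4, m2, m3, ← pow_succ]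
        abel
    obtain ⟨z, hz, hrz⟩ : ∃ z ∈ spectrum ℂ (Pc - Pi), r ≤ ‖z‖ := by
      refine gelfand_lower (Pc - Pi) hr hpos η0 ξ0 fun n hn => ?_
      obtain ⟨t, rfl⟩ := Nat.exists_eq_succ_of_ne_zero hn.ne'
      rw [Nat.succ_eq_add_one, hQ, Matrix.sub_apply, hPow]
      simp only [Pi, Matrix.of_apply]
      rw [← Complex.ofReal_sub, Complex.norm_real, Real.norm_eq_abs, abs_sub_comm]
      exact (h (t+1)).trans (le_abs_self _)
    have hz0 : z ≠ 0 := by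
      rintro rfl; simp at hrz; linarith
    rw [Matrix.mem_spectrum_iff_isRoot_charpoly, Polynomial.IsRoot.def, Matrix.eval_charpoly,
      ← Matrix.exists_mulVec_eq_zero_iff] at hz
    obtain ⟨v, hv0, hv⟩ := hz
    have hv' : (Pc - Pi).mulVec v = z • v := by
      rw [Matrix.sub_mulVec, sub_eq_zero] at hv
      rw [← hv, Matrix.scalar_apply]
      ext s; simp [Matrix.mulVec_diagonal]
    have hPiv : Pi.mulVec v = 0 := by
      have h1 : Pi.mulVec ((Pc - Pi).mulVec v) = 0 := by
        rw [Matrix.mulVec_mulVec, mul_sub, m2, m3, sub_self, Matrix.zero_mulVec]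
      rw [hv', Matrix.mulVec_smul] at h1
      exact (smul_eq_zero.1 h1).resolve_left hz0
    have hPv : Pc.mulVec v = z • v := by
      rw [← hv', Matrix.sub_mulVec, hPiv, sub_zero]
    obtain ⟨s, hs⟩ := Function.ne_iff.1 hv0
    have hL : ∑ j, (π j : ℂ) * v j = 0 := by
      have := congrFun hPiv s
      simpa [Matrix.mulVec, dotProduct, Pi] using this
    have hz1 : z ≠ 1 := by
      rintro rfl
      have h1 := heiglim 1 v hPv s
      rw [hL] at h1
      simp only [one_pow, one_mul] at h1
      exact hs (tendsto_nhds_unique tendsto_const_nhds h1)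
    refine hrz.trans (le_csSup hZfin.bddAbove ⟨z, hz1, ?_, rfl⟩)
    rw [Polynomial.IsRoot.def, Matrix.eval_charpoly, ← Matrix.exists_mulVec_eq_zero_iff]
    refine ⟨v, hv0, ?_⟩
    rw [Matrix.sub_mulVec, hPv, sub_eq_zero, Matrix.scalar_apply]
    ext s; simp [Matrix.mulVec_diagonal]
  · rcases Z.eq_empty_or_nonempty with h0 | h0
    · rw [h0, Real.sSup_empty]; norm_num
    · exact hZlt _ (h0.csSup_mem hZfin)

end spec
end ARW

namespace ARW
open Finset
set_option linter.unusedSectionVars false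
set_option linter.unusedVariables false

section walk
variable {V : Type} [Fintype V] [DecidableEq V]

structure NetR (k : V → V → ℝ) : Prop where
  nonneg : ∀ x y, 0 ≤ k x y
  row : ∀ x, ∑ y, k x y ≤ 1
  nd : ∀ Z : Finset V, Z.Nonempty → ∃ x ∈ Z, ∑ y ∈ Z, k x y < 1

lemma NetR.max_zero {k : V → V → ℝ} (hk : NetR k) (v : V → ℝ) (hv : ∀ x, 0 ≤ v x)
    (h : ∀ x, (∀ y, v y ≤ v x) → v x ≤ ∑ y, k x y * v y) (x : V) : v x = 0 := by
  by_contra hx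
  have hx : 0 < v x := lt_of_le_of_ne (hv x) (Ne.symm hx)
  obtain ⟨m, -, hm⟩ := exists_max_image univ v ⟨x, mem_univ x⟩
  have hM : 0 < v m := hx.trans_le (hm x (mem_univ x))
  obtain ⟨z, hz, hlt⟩ := hk.nd (univ.filter fun y => v y = v m) ⟨m, by simp⟩
  simp only [mem_filter, mem_univ, true_and] at hz
  have h1 := h z (fun y => hz ▸ hm y (mem_univ y))
  have h2 : ∀ y, k z y * v y ≤ k z y * v m := fun y =>
    mul_le_mul_of_nonneg_left (hm y (mem_univ y)) (hk.nonneg z y)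
  by_cases hall : ∀ y, v y ≠ v m → k z y = 0
  · have : ∑ y, k z y * v y = (∑ y ∈ univ.filter (fun y => v y = v m), k z y) * v m := by
      rw [sum_filter, sum_mul]
      refine sum_congr rfl fun y _ => ?_
      split_ifs with hy
      · rw [hy]
      · rw [hall y hy]; simp
    rw [this, hz] at h1
    nlinarith
  · push Not at hall
    obtain ⟨y, hy, hky⟩ := hall
    have h3 : ∑ y, k z y * v y < ∑ y, k z y * v m := by
      refine sum_lt_sum (fun y _ => h2 y) ⟨y, mem_univ y, ?_⟩
      exact mul_lt_mul_of_pos_left (lt_of_le_of_ne (hm y (mem_univ y)) hy)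
        (lt_of_le_of_ne (hk.nonneg z y) (Ne.symm hky))
    rw [← sum_mul] at h3
    have := mul_le_mul_of_nonneg_right (hk.row z) hM.le
    rw [hz] at h1
    linarith

lemma NetR.harm_zero {k : V → V → ℝ} (hk : NetR k) (v : V → ℝ)
    (h : ∀ x, |v x| ≤ ∑ y, k x y * |v y|) (x : V) : v x = 0 :=
  abs_eq_zero.1 (hk.max_zero (fun x => |v x|) (fun x => abs_nonneg _) (fun x _ => h x) x)

end walk

section abel
variable {V : Type} [Fintype V] [DecidableEq V]

def slp : Site → Site
  | .active 0 => .sleeping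
  | s => s

def modAt (f : Site → Site) (c : Conf V) (x : V) : Conf V := Function.update c x (f (c x))

lemma addActiveAt_eq (c : Conf V) (x : V) : addActiveAt c x = modAt Site.addActive c x := rfl

lemma modAt_comm (f g : Site → Site) (c : Conf V) {x y : V} (h : x ≠ y) :
    modAt f (modAt g c y) x = modAt g (modAt f c x) y := by
  unfold modAt
  rw [Function.update_of_ne h, Function.update_of_ne h.symm, Function.update_comm h]

lemma modAt_comm' (f g : Site → Site) (c : Conf V) {x y : V} (h : f (g (c x)) = g (f (c x))) :
    modAt f (modAt g c y) x = modAt g (modAt f c x) y := by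
  by_cases hxy : x = y
  · subst hxy
    simp [modAt, h]
  · exact modAt_comm f g c hxy

def op (x : V) : Option (Option V) → Conf V → Conf V
  | none, c => modAt slp c x
  | some none, c => modAt Site.removeOne c x
  | some (some y), c => addActiveAt (modAt Site.removeOne c x) y

lemma add_slp {s : Site} (h : s.isActive = true) : slp s.addActive = (slp s).addActive := by
  rcases s with _ | _ | _ | n <;> simp_all [Site.isActive, slp, Site.addActive]

lemma add_rem {s : Site} (h : s.isActive = true) :
    s.addActive.removeOne = s.removeOne.addActive := by
  rcases s with _ | _ | _ | n <;> simp_all [Site.isActive, Site.removeOne, Site.addActive]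

lemma add_add (c : Conf V) (x y : V) :
    addActiveAt (addActiveAt c x) y = addActiveAt (addActiveAt c y) x :=
  modAt_comm' _ _ _ rfl

lemma op_add (c : Conf V) {x : V} (h : (c x).isActive = true) (z : V) (i : Option (Option V)) :
    op x i (addActiveAt c z) = addActiveAt (op x i c) z := by
  rcases i with _ | _ | y
  · exact modAt_comm' _ _ _ (add_slp h)
  · exact modAt_comm' _ _ _ (add_rem h)
  · simp only [op]
    rw [add_add]
    congr 1
    exact modAt_comm' _ _ _ (add_rem h)

lemma isActive_add (s : Site) : s.addActive.isActive = true := by cases s <;> rfl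

lemma active_add {c : Conf V} {x : V} (h : (c x).isActive = true) (z : V) :
    (addActiveAt c z x).isActive = true := by
  unfold addActiveAt
  by_cases hx : x = z
  · subst hx; simp [isActive_add]
  · rwa [Function.update_of_ne hx]

lemma active_mod {c : Conf V} {x y : V} (h : (c x).isActive = true) (hxy : x ≠ y) (f) :
    (modAt f c y x).isActive = true := by
  unfold modAt; rwa [Function.update_of_ne hxy]

lemma active_op {c : Conf V} {x y : V} (h : (c x).isActive = true) (hxy : x ≠ y)
    (i : Option (Option V)) : (op y i c x).isActive = true := by
  rcases i with _ | _ | z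
  · exact active_mod h hxy _
  · exact active_mod h hxy _
  · exact active_add (active_mod h hxy _) z

lemma op_comm {c : Conf V} {x y : V} (hx : (c x).isActive = true) (hy : (c y).isActive = true)
    (hxy : x ≠ y) (i j : Option (Option V)) : op x i (op y j c) = op y j (op x i c) := by
  rcases j with _ | _ | z
  · rcases i with _ | _ | w
    · exact modAt_comm _ _ _ hxy
    · exact modAt_comm _ _ _ hxy
    · simp only [op]
      rw [modAt_comm _ _ _ hxy]
      exact (modAt_comm' _ _ _ (add_slp (active_mod hy hxy.symm _))).symm
  · rcases i with _ | _ | w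
    · exact modAt_comm _ _ _ hxy
    · exact modAt_comm _ _ _ hxy
    · simp only [op]
      rw [modAt_comm _ _ _ hxy]
      exact (modAt_comm' _ _ _ (add_rem (active_mod hy hxy.symm _))).symm
  · show op x i (addActiveAt (modAt Site.removeOne c y) z) = _
    rw [op_add _ (active_mod hx hxy _)]
    rcases i with _ | _ | w
    · simp only [op]; rw [modAt_comm _ _ _ hxy]
    · simp only [op]; rw [modAt_comm _ _ _ hxy]
    · simp only [op]
      rw [modAt_comm _ _ _ hxy]
      congr 1
      exact (modAt_comm' _ _ _ (add_rem (active_mod hy hxy.symm _))).symm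

noncomputable def wt (k : V → V → ℝ) (lam : ℝ) (x : V) : Option (Option V) → ℝ
  | none => lam / (1 + lam)
  | some none => (1 - ∑ y, k x y) / (1 + lam)
  | some (some y) => k x y / (1 + lam)

noncomputable def Lx (k : V → V → ℝ) (lam : ℝ) (x : V) (u : Conf V → ℝ) (c : Conf V) : ℝ :=
  ∑ i, wt k lam x i * u (op x i c)

variable {k : V → V → ℝ} {lam : ℝ}

lemma wt_nonneg (hk : NetR k) (hl : 0 < lam) (x : V) (i) : 0 ≤ wt k lam x i := by
  rcases i with _ | _ | y
  · simp only [wt]; positivity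
  · simp only [wt]; exact div_nonneg (by linarith [hk.row x]) (by linarith)
  · simp only [wt]; exact div_nonneg (hk.nonneg x y) (by linarith)

lemma wt_sum (hl : 0 < lam) (x : V) : ∑ i, wt k lam x i = 1 := by
  simp only [Fintype.sum_option, wt, ← sum_div]
  field_simp
  ring

noncomputable def Mx (k : V → V → ℝ) (x : V) (u : Conf V → ℝ) (c : Conf V) : ℝ :=
  (1 - ∑ y, k x y) * u (modAt Site.removeOne c x)
    + ∑ y, k x y * u (addActiveAt (modAt Site.removeOne c x) y)

lemma Lx_eq (hl : 0 < lam) (x : V) (u : Conf V → ℝ) (c : Conf V) :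
    Lx k lam x u c = (lam * u (modAt slp c x) + Mx k x u c) / (1 + lam) := by
  simp only [Lx, Fintype.sum_option, wt, op, Mx, add_div, sum_div]
  congr 1
  · ring
  · congr 1
    · ring
    · exact sum_congr rfl fun y _ => by ring

lemma modAt_slp {c : Conf V} {x : V} {n : ℕ} (h : c x = Site.active (n + 1)) :
    modAt slp c x = c := by
  simp [modAt, h, slp]

/-- harmonic at all active sites -/
def Harm (k : V → V → ℝ) (lam : ℝ) (u : Conf V → ℝ) : Prop :=
  ∀ c x, (c x).isActive = true → u c = Lx k lam x u c

lemma Lx_iff_Mx (hl : 0 < lam) {u : Conf V → ℝ} {c : Conf V} {x : V} {n : ℕ}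
    (h : c x = Site.active (n + 1)) : u c = Lx k lam x u c ↔ u c = Mx k x u c := by
  rw [Lx_eq hl, modAt_slp h, eq_div_iff (by linarith)]
  constructor <;> intro h <;> linarith

lemma Harm.move (hl : 0 < lam) {u : Conf V → ℝ} (hu : Harm k lam u) {c : Conf V} {x : V}
    (h : (c x).isActive = true) :
    u (addActiveAt c x) = (1 - ∑ y, k x y) * u c + ∑ y, k x y * u (addActiveAt c y) := by
  obtain ⟨n, hn⟩ : ∃ n, c x = Site.active n := by
    cases hc : c x <;> simp_all [Site.isActive]
  have h1 : addActiveAt c x x = Site.active (n + 1) := by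
    simp [addActiveAt, hn, Site.addActive]
  have h2 : modAt Site.removeOne (addActiveAt c x) x = c := by
    simp [modAt, addActiveAt, hn, Site.addActive, Site.removeOne]
  have h3 := (Lx_iff_Mx hl h1).1 (hu _ x (by rw [h1]; rfl))
  rw [h3, Mx, h2]

lemma Lx_comm {c : Conf V} {x y : V} (hx : (c x).isActive = true) (hy : (c y).isActive = true)
    (hxy : x ≠ y) (u : Conf V → ℝ) :
    Lx k lam x (Lx k lam y u) c = Lx k lam y (Lx k lam x u) c := by
  simp only [Lx, mul_sum]
  rw [sum_comm]
  refine sum_congr rfl fun i _ => sum_congr rfl fun j _ => ?_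
  rw [op_comm hx hy hxy]; ring

lemma Lx_add {c : Conf V} {x : V} (hx : (c x).isActive = true) (u : Conf V → ℝ) (z : V) :
    Lx k lam x u (addActiveAt c z) = Lx k lam x (fun c => u (addActiveAt c z)) c := by
  simp only [Lx]
  exact sum_congr rfl fun i _ => by rw [op_add c hx]

lemma Harm.add {u : Conf V → ℝ} (hu : Harm k lam u) (z : V) :
    Harm k lam (fun c => u (addActiveAt c z)) := fun c x hx => by
  rw [← Lx_add hx]; exact hu _ x (active_add hx z)

lemma Harm.sum {ι : Type} (s : Finset ι) (w : ι → ℝ) (u : ι → Conf V → ℝ)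
    (hu : ∀ i ∈ s, Harm k lam (u i)) : Harm k lam (fun c => ∑ i ∈ s, w i * u i c) := fun c x hx => by
  simp only [Lx, mul_sum]
  rw [sum_comm]
  refine sum_congr rfl fun i hi => ?_
  rw [hu i hi c x hx, Lx, mul_sum]
  exact sum_congr rfl fun j _ => by ring

lemma Harm.sub {u v : Conf V → ℝ} (hu : Harm k lam u) (hv : Harm k lam v) :
    Harm k lam (fun c => u c - v c) := fun c x hx => by
  show u c - v c = _
  rw [hu c x hx, hv c x hx]
  simp only [Lx, mul_sub, sum_sub_distrib]

lemma Harm.const (hl : 0 < lam) (a : ℝ) : Harm k lam (fun _ : Conf V => a) := fun c x hx => by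
  simp only [Lx, ← sum_mul, wt_sum hl, one_mul]

/-- approximations of the stabilization probability -/
noncomputable def aN (k : V → V → ℝ) (lam : ℝ) (ζ : Conf V) : ℕ → Conf V → ℝ
  | 0, c => if c = ζ then 1 else 0
  | n + 1, c => if h : (activeSites c).Nonempty then Lx k lam h.choose (aN k lam ζ n) c
      else if c = ζ then 1 else 0

lemma mem_activeSites {c : Conf V} {x : V} : x ∈ activeSites c ↔ (c x).isActive = true := by
  simp [activeSites]

lemma aN_indep (ζ : Conf V) (hζ : activeSites ζ = ∅) (n : ℕ) (c : Conf V) (x : V)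
    (hx : (c x).isActive = true) : aN k lam ζ (n+1) c = Lx k lam x (aN k lam ζ n) c := by
  induction n generalizing c x with
  | zero =>
    have hne : (activeSites c).Nonempty := ⟨x, mem_activeSites.2 hx⟩
    rw [aN, dif_pos hne]
    have hy := mem_activeSites.1 hne.choose_spec
    by_cases hxy : hne.choose = x
    · rw [hxy]
    have z : ∀ a b : V, (c a).isActive = true → (c b).isActive = true → a ≠ b →
        Lx k lam a (aN k lam ζ 0) c = 0 := by
      intro a b ha hb hab
      rw [Lx]
      refine sum_eq_zero fun i _ => ?_
      have : op a i c ≠ ζ := by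
        intro h
        have h1 := active_op hb hab.symm i
        rw [h, ← mem_activeSites, hζ] at h1
        simp at h1
      simp [aN, this]
    rw [z _ _ hy hx hxy, z _ _ hx hy (Ne.symm hxy)]
  | succ n ih =>
    have hne : (activeSites c).Nonempty := ⟨x, mem_activeSites.2 hx⟩
    rw [aN, dif_pos hne]
    have hy := mem_activeSites.1 hne.choose_spec
    set y := hne.choose
    by_cases hxy : y = x
    · rw [hxy]
    have e1 : Lx k lam y (aN k lam ζ (n+1)) c = Lx k lam y (Lx k lam x (aN k lam ζ n)) c :=
      sum_congr rfl fun i _ => by rw [ih _ x (active_op hx (Ne.symm hxy) i)]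
    have e2 : Lx k lam x (aN k lam ζ (n+1)) c = Lx k lam x (Lx k lam y (aN k lam ζ n)) c :=
      sum_congr rfl fun i _ => by rw [ih _ y (active_op hy hxy i)]
    rw [e1, e2, Lx_comm hy hx hxy]

lemma Lx_mono (hk : NetR k) (hl : 0 < lam) {u v : Conf V → ℝ} (h : ∀ c, u c ≤ v c) (x : V)
    (c : Conf V) : Lx k lam x u c ≤ Lx k lam x v c :=
  sum_le_sum fun i _ => mul_le_mul_of_nonneg_left (h _) (wt_nonneg hk hl x i)

lemma aN_nonneg (hk : NetR k) (hl : 0 < lam) (ζ : Conf V) (n : ℕ) (c : Conf V) :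
    0 ≤ aN k lam ζ n c := by
  induction n generalizing c with
  | zero => simp only [aN]; split_ifs <;> norm_num
  | succ n ih =>
    simp only [aN]; split_ifs
    · exact sum_nonneg fun i _ => mul_nonneg (wt_nonneg hk hl _ i) (ih _)
    · norm_num
    · norm_num

lemma aN_le_one (hk : NetR k) (hl : 0 < lam) (ζ : Conf V) (n : ℕ) (c : Conf V) :
    aN k lam ζ n c ≤ 1 := by
  induction n generalizing c with
  | zero => simp only [aN]; split_ifs <;> norm_num
  | succ n ih =>
    simp only [aN]; split_ifs with h
    · have := Lx_mono hk hl ih h.choose c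
      rw [← Harm.const (k := k) hl 1 c h.choose (mem_activeSites.1 h.choose_spec)] at this
      exact this
    · norm_num
    · norm_num

lemma aN_mono (hk : NetR k) (hl : 0 < lam) (ζ : Conf V) (hζ : activeSites ζ = ∅) (n : ℕ)
    (c : Conf V) : aN k lam ζ n c ≤ aN k lam ζ (n+1) c := by
  induction n generalizing c with
  | zero =>
    by_cases h : (activeSites c).Nonempty
    · have : c ≠ ζ := by rintro rfl; rw [hζ] at h; simp at h
      have h0 : aN k lam ζ 0 c = 0 := by simp [aN, this]
      rw [h0]; exact aN_nonneg hk hl _ _ _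
    · rw [aN, aN, dif_neg h]
  | succ n ih =>
    rw [aN, aN]
    split_ifs with h
    · exact Lx_mono hk hl ih _ _
    · exact le_rfl
    · exact le_rfl

noncomputable def hS (k : V → V → ℝ) (lam : ℝ) (ζ : Conf V) (c : Conf V) : ℝ :=
  ⨆ n, aN k lam ζ n c

lemma hS_tendsto (hk : NetR k) (hl : 0 < lam) (ζ : Conf V) (hζ : activeSites ζ = ∅) (c : Conf V) :
    Tendsto (fun n => aN k lam ζ n c) atTop (nhds (hS k lam ζ c)) :=
  tendsto_atTop_ciSup (monotone_nat_of_le_succ fun n => aN_mono hk hl ζ hζ n c)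
    ⟨1, by rintro _ ⟨n, rfl⟩; exact aN_le_one hk hl _ _ _⟩

lemma hS_harm (hk : NetR k) (hl : 0 < lam) (ζ : Conf V) (hζ : activeSites ζ = ∅) :
    Harm k lam (hS k lam ζ) := fun c x hx => by
  have h1 := (tendsto_add_atTop_iff_nat 1).2 (hS_tendsto hk hl ζ hζ c)
  refine tendsto_nhds_unique h1 ?_
  simp only [aN_indep ζ hζ _ c x hx]
  exact tendsto_finsetSum _ fun i _ => (hS_tendsto hk hl ζ hζ _).const_mul _

lemma hS_stable (hk : NetR k) (hl : 0 < lam) (ζ : Conf V) (c : Conf V)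
    (hc : activeSites c = ∅) : hS k lam ζ c = if c = ζ then 1 else 0 := by
  have : ∀ n, aN k lam ζ n c = if c = ζ then 1 else 0 := by
    intro n; cases n with
    | zero => rfl
    | succ n => rw [aN, dif_neg (by simp [hc])]
  simp [hS, this]

/-! size -/
def Site.size : Site → ℕ
  | .empty => 0
  | .sleeping => 1
  | .active n => n + 1

def csize (c : Conf V) : ℕ := ∑ x, (c x).size

lemma csize_mod (f : Site → Site) (c : Conf V) (x : V) :
    csize (modAt f c x) + (c x).size = csize c + (f (c x)).size := by
  unfold csize modAt
  rw [← add_sum_erase univ _ (mem_univ x), ← add_sum_erase univ (fun x => (c x).size) (mem_univ x)]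
  have : ∑ y ∈ univ.erase x, (Function.update c x (f (c x)) y).size
      = ∑ y ∈ univ.erase x, (c y).size :=
    sum_congr rfl fun y hy => by rw [Function.update_of_ne (ne_of_mem_erase hy)]
  rw [this]; simp; ring

lemma csize_add (c : Conf V) (x : V) : csize (addActiveAt c x) = csize c + 1 := by
  have := csize_mod Site.addActive c x
  rw [addActiveAt_eq]
  cases h : c x <;> simp [h, Site.addActive, Site.size] at this <;> omega

lemma csize_slp (c : Conf V) (x : V) : csize (modAt slp c x) = csize c := by
  have := csize_mod slp c x
  rcases h : c x with _ | _ | _ | n <;> simp [h, slp, Site.size] at this <;> omega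

lemma csize_rem {c : Conf V} {x : V} (h : (c x).isActive = true) :
    csize (modAt Site.removeOne c x) + 1 = csize c := by
  have := csize_mod Site.removeOne c x
  rcases h : c x with _ | _ | _ | n <;> simp_all [Site.removeOne, Site.size, Site.isActive]
  all_goals omega

lemma size_finite (N : ℕ) : {s : Site | s.size ≤ N}.Finite := by
  refine ((Set.finite_Iic N).image Site.active |>.union
    (Set.toFinite {Site.empty, Site.sleeping})).subset ?_
  intro s hs
  cases s with
  | empty => simp
  | sleeping => simp
  | active n =>
    left; refine ⟨n, ?_, rfl⟩
    have : n + 1 ≤ N := hs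
    simp only [Set.mem_Iic]; omega

lemma csize_finite (N : ℕ) : {c : Conf V | csize c = N}.Finite := by
  refine (Set.Finite.pi' (fun _ : V => size_finite N)).subset ?_
  intro c hc x
  have hc : csize c = N := hc
  show (c x).size ≤ N
  rw [← hc]
  exact single_le_sum (f := fun x => (c x).size) (fun _ _ => Nat.zero_le _) (mem_univ x)

/-- uniqueness of harmonic functions with given boundary values -/
lemma harm_unique (hk : NetR k) (hl : 0 < lam) {u : Conf V → ℝ} (hu : Harm k lam u) (N0 : ℕ)
    (h0 : ∀ c, activeSites c = ∅ → csize c < N0 → u c = 0) (c : Conf V) (hc : csize c < N0) :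
    u c = 0 := by
  obtain ⟨N, hN⟩ : ∃ N, csize c = N := ⟨_, rfl⟩
  induction N using Nat.strong_induction_on generalizing c with
  | _ N ih =>
  let T : V → Set ℝ := fun x => {r | ∃ c, csize c = N ∧ (c x).isActive = true ∧ r = |u c|}
  have hTb : ∀ x, BddAbove (T x) := fun x => by
    refine (((csize_finite N).image fun c : Conf V => |u c|).subset ?_).bddAbove
    rintro _ ⟨c, h1, -, rfl⟩; exact ⟨c, h1, rfl⟩
  have hTle : ∀ c x, csize c = N → (c x).isActive = true → |u c| ≤ sSup (T x) :=
    fun c x h1 h2 => le_csSup (hTb x) ⟨c, h1, h2, rfl⟩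
  have hT0 : ∀ x, 0 ≤ sSup (T x) := fun x =>
    Real.sSup_nonneg (by rintro _ ⟨c, -, -, rfl⟩; exact abs_nonneg _)
  have hNlt : N < N0 := hN ▸ hc
  have hv := hk.max_zero (fun x => sSup (T x)) hT0 (by
    intro x hmax
    have hsum0 : 0 ≤ ∑ y, k x y * sSup (T y) :=
      sum_nonneg fun y _ => mul_nonneg (hk.nonneg x y) (hT0 y)
    have hbd : sSup (T x) ≤ (lam * sSup (T x) + ∑ y, k x y * sSup (T y)) / (1 + lam) := by
      refine Real.sSup_le ?_ (div_nonneg (add_nonneg (mul_nonneg hl.le (hT0 x)) hsum0) (by linarith))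
      rintro _ ⟨d, hd, hdx, rfl⟩
      rw [hu d x hdx, Lx_eq hl, abs_div, abs_of_pos (show 0 < 1 + lam by linarith)]
      apply div_le_div_of_nonneg_right _ (by linarith)
      refine (abs_add_le _ _).trans (add_le_add ?_ ?_)
      · rw [abs_mul, abs_of_pos hl]
        apply mul_le_mul_of_nonneg_left _ hl.le
        set e := modAt slp d x with he
        have hes : csize e = N := by rw [he, csize_slp, hd]
        rcases (activeSites e).eq_empty_or_nonempty with h | ⟨y, hy⟩
        · rw [h0 e h (hes ▸ hNlt)]; simpa using hT0 x
        · exact (hTle e y hes (mem_activeSites.1 hy)).trans (hmax y)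
      · have hr := csize_rem hdx
        rw [Mx, ih (N - 1) (by omega) (modAt Site.removeOne d x) (by omega) (by omega), mul_zero,
          zero_add]
        refine (abs_sum_le_sum_abs _ _).trans (sum_le_sum fun y _ => ?_)
        rw [abs_mul, abs_of_nonneg (hk.nonneg x y)]
        apply mul_le_mul_of_nonneg_left _ (hk.nonneg x y)
        apply hTle
        · rw [csize_add]; omega
        · simp [addActiveAt, isActive_add]
    rw [le_div_iff₀ (by linarith)] at hbd
    show sSup (T x) ≤ ∑ y, k x y * sSup (T y)
    linarith)
  rcases (activeSites c).eq_empty_or_nonempty with h | ⟨y, hy⟩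
  · exact h0 c h hc
  · have := hTle c y hN (mem_activeSites.1 hy)
    have h2 : sSup (T y) = 0 := hv y
    rw [h2] at this
    exact abs_eq_zero.1 (le_antisymm this (abs_nonneg _))

end abel
end ARW

namespace ARW
open Finset
set_option linter.unusedSectionVars false
set_option linter.unusedVariables false

section link
variable {V : Type} [Fintype V] [DecidableEq V]

lemma K_ne_top {K : V → V → ℝ≥0∞} (hsub : SubStochastic K) (x y : V) : K x y ≠ ⊤ := by
  refine ne_top_of_le_ne_top ENNReal.one_ne_top (le_trans ?_ (hsub x))
  exact single_le_sum (f := fun y => K x y) (fun _ _ => zero_le) (mem_univ y)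

def kR (K : V → V → ℝ≥0∞) (x y : V) : ℝ := (K x y).toReal

lemma kR_sum {K : V → V → ℝ≥0∞} (hsub : SubStochastic K) (x : V) (Z : Finset V) :
    ∑ y ∈ Z, kR K x y = (∑ y ∈ Z, K x y).toReal :=
  (ENNReal.toReal_sum fun y _ => K_ne_top hsub x y).symm

lemma kR_net {K : V → V → ℝ≥0∞} (hsub : SubStochastic K) (hnd : NonDegenerate K) :
    NetR (kR K) where
  nonneg x y := ENNReal.toReal_nonneg
  row x := by
    rw [kR_sum hsub]
    exact ENNReal.toReal_le_of_le_ofReal zero_le_one (by simpa using hsub x)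
  nd Z hZ := by
    obtain ⟨x, hx, h⟩ := hnd Z hZ
    refine ⟨x, hx, ?_⟩
    have h1 : ∑ y ∈ Z, K x y ≤ 1 := (sum_le_sum_of_subset (subset_univ Z)).trans (hsub x)
    have h2 : ∑ y ∈ Z, K x y < 1 := lt_of_le_of_ne h1 h
    rw [kR_sum hsub]
    have := (ENNReal.toReal_lt_toReal h2.ne_top ENNReal.one_ne_top).2 h2
    simpa using this

lemma kill_toReal {K : V → V → ℝ≥0∞} (hsub : SubStochastic K) (x : V) :
    (1 - ∑ y, K x y).toReal = 1 - ∑ y, kR K x y := by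
  rw [ENNReal.toReal_sub_of_le (hsub x) ENNReal.one_ne_top, kR_sum hsub]; simp

lemma tsum_single (a : Conf V) (w : ℝ≥0∞) (F : Conf V → ℝ≥0∞) :
    ∑' σ, (if σ = a then w else 0) * F σ = w * F a := by
  rw [tsum_eq_single a]
  · simp
  · intro b hb; simp [hb]

lemma tsum_md (K : V → V → ℝ≥0∞) (x : V) (c : Conf V) (F : Conf V → ℝ≥0∞) :
    ∑' σ, ((∑ y, if σ = addActiveAt (modAt Site.removeOne c x) y then K x y else 0)
      + (if σ = modAt Site.removeOne c x then 1 - ∑ y, K x y else 0)) * F σ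
    = ∑ y, K x y * F (addActiveAt (modAt Site.removeOne c x) y)
      + (1 - ∑ y, K x y) * F (modAt Site.removeOne c x) := by
  simp only [add_mul, sum_mul]
  rw [ENNReal.tsum_add, Summable.tsum_finsetSum (fun _ _ => ENNReal.summable), tsum_single]
  congr 1
  exact sum_congr rfl fun y _ => tsum_single _ _ _

lemma topple_stable (K : V → V → ℝ≥0∞) (lam : ℝ) (c : Conf V) (h : ¬ (activeSites c).Nonempty)
    (F : Conf V → ℝ≥0∞) : ∑' σ, toppleKernel K lam c σ * F σ = F c := by
  simp only [toppleKernel, dif_neg h]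
  rw [tsum_single, one_mul]

lemma topple_multi (K : V → V → ℝ≥0∞) (lam : ℝ) (c : Conf V) (h : (activeSites c).Nonempty)
    (h0 : c h.choose ≠ Site.active 0) (F : Conf V → ℝ≥0∞) :
    ∑' σ, toppleKernel K lam c σ * F σ =
     ∑ y, K h.choose y * F (addActiveAt (modAt Site.removeOne c h.choose) y)
      + (1 - ∑ y, K h.choose y) * F (modAt Site.removeOne c h.choose) := by
  simp only [toppleKernel, dif_pos h, if_neg h0]
  exact tsum_md K h.choose c F

lemma topple_alone (K : V → V → ℝ≥0∞) (lam : ℝ) (c : Conf V) (h : (activeSites c).Nonempty)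
    (h0 : c h.choose = Site.active 0) (F : Conf V → ℝ≥0∞) :
    ∑' σ, toppleKernel K lam c σ * F σ =
     (ENNReal.ofReal lam * F (modAt slp c h.choose) +
      (∑ y, K h.choose y * F (addActiveAt (modAt Site.removeOne c h.choose) y)
      + (1 - ∑ y, K h.choose y) * F (modAt Site.removeOne c h.choose)))
       / (ENNReal.ofReal lam + 1) := by
  simp only [toppleKernel, dif_pos h, if_pos h0]
  rw [← tsum_md K h.choose c F]
  have e : modAt slp c h.choose = Function.update c h.choose Site.sleeping := by
    simp [modAt, h0, slp]
  rw [e, ← tsum_single _ (ENNReal.ofReal lam) F, ← ENNReal.tsum_add, div_eq_mul_inv,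
    ← ENNReal.tsum_mul_right]
  refine tsum_congr fun σ => ?_
  simp only [modAt]
  rw [div_eq_mul_inv]
  rw [← add_mul, add_assoc, mul_right_comm]
  rfl

variable {K : V → V → ℝ≥0∞} {lam : ℝ}

lemma md_toReal (hsub : SubStochastic K) (x : V) (c : Conf V) (F : Conf V → ℝ≥0∞)
    (hF : ∀ σ, F σ ≠ ⊤) :
    (∑ y, K x y * F (addActiveAt (modAt Site.removeOne c x) y)
      + (1 - ∑ y, K x y) * F (modAt Site.removeOne c x)) ≠ ⊤ ∧
    (∑ y, K x y * F (addActiveAt (modAt Site.removeOne c x) y)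
      + (1 - ∑ y, K x y) * F (modAt Site.removeOne c x)).toReal
      = Mx (kR K) x (fun σ => (F σ).toReal) c := by
  have t1 : ∑ y, K x y * F (addActiveAt (modAt Site.removeOne c x) y) ≠ ⊤ :=
    ENNReal.sum_ne_top.2 fun y _ => ENNReal.mul_ne_top (K_ne_top hsub x y) (hF _)
  have t2 : (1 - ∑ y, K x y) * F (modAt Site.removeOne c x) ≠ ⊤ :=
    ENNReal.mul_ne_top (ENNReal.sub_ne_top ENNReal.one_ne_top) (hF _)
  refine ⟨ENNReal.add_ne_top.2 ⟨t1, t2⟩, ?_⟩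
  rw [ENNReal.toReal_add t1 t2, ENNReal.toReal_sum
    (fun y _ => ENNReal.mul_ne_top (K_ne_top hsub x y) (hF _)), ENNReal.toReal_mul, kill_toReal hsub,
    Mx, add_comm]
  congr 1
  exact sum_congr rfl fun y _ => ENNReal.toReal_mul

/-- real version of one toppling step -/
noncomputable def Tc (K : V → V → ℝ≥0∞) (lam : ℝ) (u : Conf V → ℝ) (c : Conf V) : ℝ :=
  if h : (activeSites c).Nonempty then
    if c h.choose = Site.active 0 then Lx (kR K) lam h.choose u c else Mx (kR K) h.choose u c
  else u c

lemma topple_toReal (hsub : SubStochastic K) (hl : 0 < lam) (c : Conf V) (F : Conf V → ℝ≥0∞)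
    (hF : ∀ σ, F σ ≠ ⊤) :
    (∑' σ, toppleKernel K lam c σ * F σ) ≠ ⊤ ∧
    (∑' σ, toppleKernel K lam c σ * F σ).toReal = Tc K lam (fun σ => (F σ).toReal) c := by
  by_cases h : (activeSites c).Nonempty
  · rw [Tc, dif_pos h]
    obtain ⟨m1, m2⟩ := md_toReal hsub h.choose c F hF
    by_cases h0 : c h.choose = Site.active 0
    · rw [if_pos h0, topple_alone K lam c h h0]
      have t1 : ENNReal.ofReal lam * F (modAt slp c h.choose) ≠ ⊤ :=
        ENNReal.mul_ne_top ENNReal.ofReal_ne_top (hF _)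
      refine ⟨ENNReal.div_ne_top (ENNReal.add_ne_top.2 ⟨t1, m1⟩) (by simp), ?_⟩
      rw [ENNReal.toReal_div, ENNReal.toReal_add t1 m1, m2, ENNReal.toReal_mul,
        ENNReal.toReal_ofReal hl.le, ENNReal.toReal_add ENNReal.ofReal_ne_top ENNReal.one_ne_top,
        ENNReal.toReal_ofReal hl.le, Lx_eq hl, ENNReal.toReal_one, add_comm lam 1]
    · rw [if_neg h0, topple_multi K lam c h h0]
      exact ⟨m1, m2⟩
  · rw [Tc, dif_neg h, topple_stable K lam c h]
    exact ⟨hF c, rfl⟩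

lemma choose_cases {c : Conf V} (h : (activeSites c).Nonempty) (h0 : c h.choose ≠ Site.active 0) :
    ∃ n, c h.choose = Site.active (n + 1) := by
  have := mem_activeSites.1 h.choose_spec
  rcases hc : c h.choose with _ | _ | _ | n
  · rw [hc] at this; simp [Site.isActive] at this
  · rw [hc] at this; simp [Site.isActive] at this
  · exact absurd hc h0
  · exact ⟨n, rfl⟩

lemma Tc_fix_iff (hl : 0 < lam) (u : Conf V → ℝ) (c : Conf V) (h : (activeSites c).Nonempty) :
    u c = Tc K lam u c ↔ u c = Lx (kR K) lam h.choose u c := by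
  rw [Tc, dif_pos h]
  split_ifs with h0
  · exact Iff.rfl
  · obtain ⟨n, hn⟩ := choose_cases h h0
    exact (Lx_iff_Mx hl hn).symm

lemma Mx_mono {k : V → V → ℝ} (hk : NetR k) {u v : Conf V → ℝ} (h : ∀ c, u c ≤ v c) (x : V)
    (c : Conf V) : Mx k x u c ≤ Mx k x v c :=
  add_le_add (mul_le_mul_of_nonneg_left (h _) (by linarith [hk.row x]))
    (sum_le_sum fun y _ => mul_le_mul_of_nonneg_left (h _) (hk.nonneg x y))

lemma Tc_mono (hk : NetR (kR K)) (hl : 0 < lam) {u v : Conf V → ℝ} (h : ∀ c, u c ≤ v c)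
    (c : Conf V) : Tc K lam u c ≤ Tc K lam v c := by
  unfold Tc
  split_ifs
  · exact Lx_mono hk hl h _ _
  · exact Mx_mono hk h _ _
  · exact h c

lemma stab_eq (hsub : SubStochastic K) (hnd : NonDegenerate K) (hl : 0 < lam) (ζ : Conf V)
    (hζ : activeSites ζ = ∅) (c : Conf V) :
    (⨆ t, kernelPow (toppleKernel K lam) t c ζ) ≠ ⊤ ∧
    (⨆ t, kernelPow (toppleKernel K lam) t c ζ).toReal = hS (kR K) lam ζ c := by
  have hk := kR_net hsub hnd
  set b : ℕ → Conf V → ℝ≥0∞ := fun t c => kernelPow (toppleKernel K lam) t c ζ with hb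
  have b0 : ∀ c, b 0 c = if ζ = c then 1 else 0 := fun c => rfl
  have bs : ∀ t c, b (t+1) c = ∑' σ, toppleKernel K lam c σ * b t σ := fun t c => rfl
  have hharm := hS_harm (k := kR K) hk hl ζ hζ
  have hTh : ∀ c, hS (kR K) lam ζ c = Tc K lam (hS (kR K) lam ζ) c := by
    intro c
    by_cases h : (activeSites c).Nonempty
    · exact (Tc_fix_iff hl _ c h).2 (hharm c _ (mem_activeSites.1 h.choose_spec))
    · rw [Tc, dif_neg h]
  have h0 : ∀ c, 0 ≤ hS (kR K) lam ζ c := fun c =>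
    ge_of_tendsto' (hS_tendsto hk hl ζ hζ c) fun n => aN_nonneg hk hl ζ n c
  have c1 : ∀ t c, b t c ≠ ⊤ ∧ (b t c).toReal ≤ hS (kR K) lam ζ c := by
    intro t
    induction t with
    | zero =>
      intro c
      rw [b0]
      split_ifs with h
      · subst h
        rw [hS_stable hk hl _ _ hζ]; simp
      · simpa using h0 c
    | succ t ih =>
      intro c
      rw [bs]
      obtain ⟨e1, e2⟩ := topple_toReal hsub hl c (b t) (fun σ => (ih σ).1)
      refine ⟨e1, ?_⟩
      rw [e2, hTh]
      exact Tc_mono hk hl (fun σ => (ih σ).2) c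
  have bmono : ∀ c, Monotone fun t => b t c := by
    have : ∀ t c, b t c ≤ b (t+1) c := by
      intro t
      induction t with
      | zero =>
        intro c
        rw [bs]
        by_cases h : (activeSites c).Nonempty
        · rw [b0, if_neg]
          · exact zero_le
          · rintro rfl; rw [hζ] at h; simp at h
        · rw [topple_stable K lam c h]
      | succ t ih =>
        intro c
        rw [bs, bs]
        exact ENNReal.tsum_le_tsum fun σ => mul_le_mul_right (ih σ) _
    exact fun c => monotone_nat_of_le_succ fun t => this t c
  have hle : ∀ c, (⨆ t, b t c) ≤ ENNReal.ofReal (hS (kR K) lam ζ c) := fun c =>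
    iSup_le fun t => (ENNReal.le_ofReal_iff_toReal_le (c1 t c).1 (h0 c)).2 (c1 t c).2
  have hfin : ∀ c, (⨆ t, b t c) ≠ ⊤ := fun c =>
    ne_top_of_le_ne_top ENNReal.ofReal_ne_top (hle c)
  set H : Conf V → ℝ := fun c => (⨆ t, b t c).toReal with hH
  have hlim : ∀ c, Tendsto (fun t => (b t c).toReal) atTop (nhds (H c)) := fun c =>
    (ENNReal.tendsto_toReal (hfin c)).comp (tendsto_atTop_iSup (bmono c))
  have HT : ∀ c, H c = Tc K lam H c := by
    intro c
    have l1 := (tendsto_add_atTop_iff_nat 1).2 (hlim c)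
    refine tendsto_nhds_unique l1 ?_
    have : ∀ t, (b (t+1) c).toReal = Tc K lam (fun σ => (b t σ).toReal) c := fun t => by
      rw [bs]; exact (topple_toReal hsub hl c (b t) (fun σ => (c1 t σ).1)).2
    simp only [this]
    unfold Tc
    split_ifs
    · exact tendsto_finsetSum _ fun i _ => (hlim _).const_mul _
    · exact ((hlim _).const_mul _).add (tendsto_finsetSum _ fun i _ => (hlim _).const_mul _)
    · exact hlim c
  have c2 : ∀ n c, aN (kR K) lam ζ n c ≤ H c := by
    have base : ∀ c, (if c = ζ then (1:ℝ) else 0) ≤ H c := by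
      intro c
      split_ifs with h
      · have := ENNReal.toReal_mono (hfin c) (le_iSup (fun t => b t c) 0)
        rw [b0, if_pos h.symm] at this
        simpa using this
      · exact ENNReal.toReal_nonneg
    intro n
    induction n with
    | zero => exact base
    | succ n ih =>
      intro c
      rw [aN]
      split_ifs with h h'
      · rw [(Tc_fix_iff hl H c h).1 (HT c)]
        exact Lx_mono hk hl ih _ _
      · simpa [h'] using base c
      · exact ENNReal.toReal_nonneg
  refine ⟨hfin c, le_antisymm ?_ (ciSup_le fun n => c2 n c)⟩
  exact ENNReal.toReal_le_of_le_ofReal (h0 c) (hle c)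

lemma embed_stable (b : V → Bool) : activeSites (embed b) = ∅ := by
  ext x; rw [mem_activeSites]; unfold embed; split_ifs <;> simp [Site.isActive]

lemma embed_inj {b b' : V → Bool} (h : embed b = embed b') : b = b' := by
  funext x
  have := congrFun h x
  unfold embed at this
  cases hb : b x <;> cases hb' : b' x <;> simp_all

lemma stable_embed {c : Conf V} (h : activeSites c = ∅) : ∃ b, c = embed b := by
  refine ⟨fun x => decide (c x = Site.sleeping), ?_⟩
  funext x
  have hx : x ∉ activeSites c := by rw [h]; simp
  rw [mem_activeSites] at hx
  unfold embed
  cases hc : c x <;> simp_all [Site.isActive]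

lemma arwMatrix_apply (hsub : SubStochastic K) (hnd : NonDegenerate K) (hl : 0 < lam)
    {ν : V → ℝ≥0∞} (hν : ∀ x, ν x ≠ ⊤) (η ξ : V → Bool) :
    arwMatrix K lam ν η ξ
      = ∑ x, (ν x).toReal * hS (kR K) lam (embed ξ) (addActiveAt (embed η) x) := by
  simp only [arwMatrix, Matrix.of_apply, arwStep]
  rw [ENNReal.toReal_sum fun x _ => ENNReal.mul_ne_top (hν x)
    (stab_eq hsub hnd hl _ (embed_stable ξ) _).1]
  refine sum_congr rfl fun x _ => ?_
  rw [ENNReal.toReal_mul, (stab_eq hsub hnd hl _ (embed_stable ξ) _).2]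

end link
end ARW

namespace ARW
open Finset
set_option linter.unusedSectionVars false
set_option linter.unusedVariables false

section idla
variable {V : Type} [Fintype V] [DecidableEq V]

lemma idla_ext (A : Finset V) (w : List V) : A ⊆ idlaUpdate A w := by
  induction w with
  | nil => exact Subset.refl _
  | cons x w ih => rw [idlaUpdate]; split_ifs; exacts [ih, subset_insert _ _]

lemma idla_step (A : Finset V) (w : List V) :
    idlaUpdate A w = A ∨ ∃ z, idlaUpdate A w = insert z A := by
  induction w with
  | nil => exact Or.inl rfl
  | cons x w ih => rw [idlaUpdate]; split_ifs; exacts [ih, Or.inr ⟨x, rfl⟩]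

lemma idla_mono (w : List V) : Monotone fun A : Finset V => idlaUpdate A w := by
  intro A B h
  induction w with
  | nil => exact h
  | cons x w ih =>
    simp only [idlaUpdate]
    split_ifs with h1 h2 h2
    · exact ih
    · exact absurd (h h1) h2
    · exact insert_subset (idla_ext B w h2) (h.trans (idla_ext B w))
    · exact insert_subset_insert _ h

lemma idla_ins (w : List V) (A : Finset V) (x : V) :
    ∃ z, idlaUpdate (insert x A) w = insert z (idlaUpdate A w) := by
  induction w with
  | nil => exact ⟨x, rfl⟩
  | cons y w ih =>
    simp only [idlaUpdate]
    by_cases h1 : y ∈ A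
    · rw [if_pos h1, if_pos (mem_insert_of_mem h1)]; exact ih
    · rw [if_neg h1]
      by_cases h2 : y = x
      · subst h2
        rw [if_pos (mem_insert_self _ _)]
        rcases idla_step (insert y A) w with h | ⟨z, h⟩
        · exact ⟨y, by rw [h]; simp⟩
        · exact ⟨z, h⟩
      · rw [if_neg (by simp [h1, h2])]
        exact ⟨x, Finset.insert_comm _ _ _⟩

lemma idla_hit (w : List V) (z : V) (h : z ∈ w) : idlaUpdate (univ.erase z) w = univ := by
  induction w with
  | nil => simp at h
  | cons y w ih =>
    rw [idlaUpdate]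
    by_cases hy : y = z
    · subst hy
      rw [if_neg (by simp)]; simp
    · rw [if_pos (by simp [hy])]
      exact ih (by simpa [Ne.symm hy] using h)

noncomputable def Wk (K : V → V → ℝ≥0∞) (x : V) (F : List V → ℝ≥0∞) : ℝ≥0∞ :=
  ∑' w, pathProb K x w * F w

def listEq (V : Type) : Unit ⊕ (V × List V) ≃ List V where
  toFun s := match s with
    | .inl _ => []
    | .inr p => p.1 :: p.2
  invFun l := match l with
    | [] => .inl ()
    | a :: l => .inr (a, l)
  left_inv s := by rcases s with _ | p <;> rfl
  right_inv l := by cases l <;> rfl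

lemma Wk_rec (K : V → V → ℝ≥0∞) (x : V) (F : List V → ℝ≥0∞) :
    Wk K x F = (1 - ∑ y, K x y) * F [] + ∑ y, K x y * Wk K y (fun w => F (y :: w)) := by
  unfold Wk
  rw [← (listEq V).tsum_eq]
  rw [Summable.tsum_sum ENNReal.summable ENNReal.summable]
  congr 1
  · rw [tsum_fintype]; simp [listEq, pathProb]
  · rw [ENNReal.tsum_prod', tsum_fintype]
    refine sum_congr rfl fun y _ => ?_
    rw [← ENNReal.tsum_mul_left]
    refine tsum_congr fun w => ?_
    simp [listEq, pathProb, mul_assoc]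

variable {K : V → V → ℝ≥0∞}

lemma Wk_mono (x : V) {F G : List V → ℝ≥0∞} (h : ∀ w, F w ≤ G w) : Wk K x F ≤ Wk K x G :=
  ENNReal.tsum_le_tsum fun w => mul_le_mul_right (h w) _

lemma Wk_trunc (hsub : SubStochastic K) (n : ℕ) (x : V) :
    Wk K x (fun w => if w.length < n then 1 else 0) ≤ 1 := by
  induction n generalizing x with
  | zero => simp [Wk]
  | succ n ih =>
    rw [Wk_rec]
    calc _ ≤ (1 - ∑ y, K x y) * 1 + ∑ y, K x y * 1 := by
          refine add_le_add (by simp) (sum_le_sum fun y _ => mul_le_mul_right ?_ _)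
          simpa using ih y
      _ = 1 := by simp only [mul_one]; exact tsub_add_cancel_of_le (hsub x)

lemma Wk_one_le (hsub : SubStochastic K) (x : V) : Wk K x (fun _ => 1) ≤ 1 := by
  unfold Wk
  rw [ENNReal.tsum_eq_iSup_sum]
  refine iSup_le fun s => ?_
  obtain ⟨n, hn⟩ : ∃ n, ∀ w ∈ s, w.length < n :=
    ⟨s.sup List.length + 1, fun w hw => Nat.lt_succ_of_le (le_sup (f := List.length) hw)⟩
  refine le_trans ?_ (Wk_trunc hsub n x)
  refine le_trans (sum_le_sum fun w hw => ?_) (ENNReal.sum_le_tsum s)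
  simp only [if_pos (hn w hw)]; exact le_rfl

lemma Wk_ne_top (hsub : SubStochastic K) (x : V) {F : List V → ℝ≥0∞} (h : ∀ w, F w ≤ 1) :
    Wk K x F ≠ ⊤ :=
  ne_top_of_le_ne_top ENNReal.one_ne_top ((Wk_mono x h).trans (Wk_one_le hsub x))

lemma Wk_one (hsub : SubStochastic K) (hnd : NonDegenerate K) (x : V) :
    (Wk K x (fun _ => 1)).toReal = 1 := by
  have hk := kR_net hsub hnd
  have ht : ∀ x, Wk K x (fun _ => 1) ≠ ⊤ := fun x => Wk_ne_top hsub x fun _ => le_rfl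
  have hr : ∀ x, (Wk K x (fun _ => 1)).toReal
      = (1 - ∑ y, kR K x y) + ∑ y, kR K x y * (Wk K y (fun _ => 1)).toReal := by
    intro x
    conv_lhs => rw [Wk_rec]
    rw [mul_one, ENNReal.toReal_add (ENNReal.sub_ne_top ENNReal.one_ne_top)
      (ENNReal.sum_ne_top.2 fun y _ => ENNReal.mul_ne_top (K_ne_top hsub x y) (ht y)),
      kill_toReal hsub, ENNReal.toReal_sum
      (fun y _ => ENNReal.mul_ne_top (K_ne_top hsub x y) (ht y))]
    simp only [ENNReal.toReal_mul, kR]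
  have := hk.harm_zero (fun x => (Wk K x (fun _ => 1)).toReal - 1) (fun x => by
    rw [hr x]
    have : 1 - ∑ y, kR K x y + ∑ y, kR K x y * (Wk K y fun _ => 1).toReal - 1
        = ∑ y, kR K x y * ((Wk K y fun _ => 1).toReal - 1) := by
      simp only [mul_sub, sum_sub_distrib, mul_one]; ring
    rw [this]
    refine (abs_sum_le_sum_abs _ _).trans (le_of_eq (sum_congr rfl fun y _ => ?_))
    rw [abs_mul, abs_of_nonneg (hk.nonneg x y)]) x
  linarith

/-- law of the IDLA map of a walk started at x -/
noncomputable def pE (K : V → V → ℝ≥0∞) (x : V) (g : Finset V → Finset V) : ℝ≥0∞ :=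
  Wk K x (fun w => if (fun A => idlaUpdate A (x :: w)) = g then 1 else 0)

noncomputable def eE (K : V → V → ℝ≥0∞) (x : V) (A B : Finset V) : ℝ≥0∞ :=
  Wk K x (fun w => if idlaUpdate A (x :: w) = B then 1 else 0)

lemma ite_le_one' (p : Prop) [Decidable p] : (if p then (1:ℝ≥0∞) else 0) ≤ 1 := by
  split_ifs <;> simp

lemma pE_ne_top (hsub : SubStochastic K) (x g) : pE K x g ≠ ⊤ :=
  Wk_ne_top hsub x fun w => ite_le_one' _
lemma eE_ne_top (hsub : SubStochastic K) (x A B) : eE K x A B ≠ ⊤ :=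
  Wk_ne_top hsub x fun w => ite_le_one' _

lemma Wk_finsum {ι : Type} (s : Finset ι) (x : V) (F : ι → List V → ℝ≥0∞) :
    ∑ i ∈ s, Wk K x (F i) = Wk K x (fun w => ∑ i ∈ s, F i w) := by
  unfold Wk
  rw [← Summable.tsum_finsetSum (fun _ _ => ENNReal.summable)]
  exact tsum_congr fun w => (mul_sum _ _ _).symm

lemma eE_eq (x : V) (A B : Finset V) : eE K x A B = ∑ g : Finset V → Finset V,
    if g A = B then pE K x g else 0 := by
  rw [← sum_filter]
  unfold pE
  rw [Wk_finsum]
  unfold eE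
  congr 1
  funext w
  rw [sum_ite_eq]
  simp

lemma pE_sum (x : V) : ∑ g, pE K x g = Wk K x (fun _ => 1) := by
  unfold pE
  rw [Wk_finsum]
  congr 1
  funext w
  simp

lemma eE_notMem (x : V) {A : Finset V} (h : x ∉ A) (B : Finset V) :
    eE K x A B = if insert x A = B then Wk K x (fun _ => 1) else 0 := by
  unfold eE
  simp only [idlaUpdate, if_neg h]
  split_ifs
  · rfl
  · simp [Wk]

lemma eE_mem (x : V) {A : Finset V} (h : x ∈ A) (B : Finset V) :
    eE K x A B = (1 - ∑ y, K x y) * (if A = B then 1 else 0) + ∑ y, K x y * eE K y A B := by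
  unfold eE
  rw [Wk_rec]
  simp only [idlaUpdate, if_pos h]
  rfl

lemma eE_real (hsub : SubStochastic K) (x : V) (A : Finset V) (ψ : Finset V → ℝ) :
    ∑ g, (pE K x g).toReal * ψ (g A) = ∑ B, (eE K x A B).toReal * ψ B := by
  have : ∀ B, (eE K x A B).toReal = ∑ g : Finset V → Finset V,
      if g A = B then (pE K x g).toReal else 0 := by
    intro B
    rw [eE_eq, ENNReal.toReal_sum]
    · exact sum_congr rfl fun g _ => by split_ifs <;> simp
    · intro g _; split_ifs
      · exact pE_ne_top hsub x g
      · simp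
  simp only [this, sum_mul]
  rw [sum_comm]
  refine sum_congr rfl fun g _ => ?_
  simp

lemma avg_notMem (hsub : SubStochastic K) (hnd : NonDegenerate K) (x : V) {A : Finset V}
    (h : x ∉ A) (ψ : Finset V → ℝ) :
    ∑ g, (pE K x g).toReal * ψ (g A) = ψ (insert x A) := by
  rw [eE_real hsub]
  simp only [eE_notMem x h]
  rw [sum_eq_single (insert x A)]
  · rw [if_pos rfl, Wk_one hsub hnd, one_mul]
  · intro B _ hB; rw [if_neg (Ne.symm hB)]; simp
  · simp

lemma avg_mem (hsub : SubStochastic K) (x : V) {A : Finset V}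
    (h : x ∈ A) (ψ : Finset V → ℝ) :
    ∑ g, (pE K x g).toReal * ψ (g A) = (1 - ∑ y, kR K x y) * ψ A
      + ∑ y, kR K x y * ∑ g, (pE K y g).toReal * ψ (g A) := by
  simp only [eE_real hsub]
  have : ∀ B, (eE K x A B).toReal = (1 - ∑ y, kR K x y) * (if A = B then 1 else 0)
      + ∑ y, kR K x y * (eE K y A B).toReal := by
    intro B
    have t : ∀ y ∈ (univ : Finset V), K x y * eE K y A B ≠ ⊤ := fun y _ =>
      ENNReal.mul_ne_top (K_ne_top hsub x y) (eE_ne_top hsub y A B)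
    rw [eE_mem x h, ENNReal.toReal_add _ (ENNReal.sum_ne_top.2 t), ENNReal.toReal_mul,
      kill_toReal hsub, ENNReal.toReal_sum t]
    · congr 1
      · split_ifs <;> simp
      · exact sum_congr rfl fun y _ => ENNReal.toReal_mul
    · refine ENNReal.mul_ne_top (ENNReal.sub_ne_top ENNReal.one_ne_top) ?_
      split_ifs <;> simp
  simp only [this, add_mul, sum_add_distrib, sum_mul, mul_sum]
  congr 1
  · simp
  · rw [sum_comm]
    exact sum_congr rfl fun y _ => sum_congr rfl fun B _ => mul_assoc _ _ _

/-- law of the IDLA map -/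
noncomputable def pI (K : V → V → ℝ≥0∞) (ν : V → ℝ≥0∞) (g : Finset V → Finset V) : ℝ :=
  ∑ x, (ν x).toReal * (pE K x g).toReal

lemma pI_avg (ν : V → ℝ≥0∞) (φ : (Finset V → Finset V) → ℝ) :
    ∑ g, pI K ν g * φ g = ∑ x, (ν x).toReal * ∑ g, (pE K x g).toReal * φ g := by
  simp only [pI, sum_mul, mul_sum]
  rw [sum_comm]
  exact sum_congr rfl fun y _ => sum_congr rfl fun B _ => mul_assoc _ _ _

lemma nu_ne_top {ν : V → ℝ≥0∞} (hν : IsProbVec ν) (x : V) : ν x ≠ ⊤ := by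
  refine ne_top_of_le_ne_top ENNReal.one_ne_top ?_
  rw [← hν]
  exact single_le_sum (f := ν) (fun _ _ => zero_le) (mem_univ x)

lemma nu_sum {ν : V → ℝ≥0∞} (hν : IsProbVec ν) : ∑ x, (ν x).toReal = 1 := by
  rw [← ENNReal.toReal_sum fun x _ => nu_ne_top hν x, hν]; simp

lemma pI_supp {ν : V → ℝ≥0∞} {g : Finset V → Finset V} (h : pI K ν g ≠ 0) :
    ∃ w : List V, g = fun A => idlaUpdate A w := by
  obtain ⟨x, -, hx⟩ := exists_ne_zero_of_sum_ne_zero h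
  have : pE K x g ≠ 0 := by intro h0; simp [h0] at hx
  by_contra hc
  push Not at hc
  apply this
  unfold pE
  have : (fun w => if (fun A => idlaUpdate A (x :: w)) = g then (1:ℝ≥0∞) else 0) = fun _ => 0 := by
    funext w; rw [if_neg]; exact fun h => hc _ h.symm
  rw [this]; simp [Wk]

lemma pI_good (hsub : SubStochastic K) (hnd : NonDegenerate K) {ν : V → ℝ≥0∞}
    (hν : IsProbVec ν) : Good (pI K ν) where
  nonneg g := sum_nonneg fun x _ => mul_nonneg ENNReal.toReal_nonneg ENNReal.toReal_nonneg
  sum_one := by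
    have := pI_avg (K := K) ν (fun _ => 1)
    simp only [mul_one] at this
    rw [this, ← nu_sum hν]
    refine sum_congr rfl fun x _ => ?_
    rw [← ENNReal.toReal_sum fun g _ => pE_ne_top hsub x g, pE_sum, Wk_one hsub hnd, mul_one]
  mono g h := by obtain ⟨w, rfl⟩ := pI_supp h; exact idla_mono w
  ext g h := by obtain ⟨w, rfl⟩ := pI_supp h; exact fun A => idla_ext A w
  ins g h := by obtain ⟨w, rfl⟩ := pI_supp h; exact fun A x => idla_ins w A x
  step g h := by obtain ⟨w, rfl⟩ := pI_supp h; exact fun A => idla_step A w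

lemma pz_pos (hsub : SubStochastic K) (hnd : NonDegenerate K) {ν : V → ℝ≥0∞}
    (hν : IsProbVec ν) (hadm : Admissible K ν) (z : V) : 0 < pz (pI K ν) z := by
  have hp := pI_good hsub hnd hν
  have h := hadm z
  obtain ⟨w, hw⟩ : ∃ w : List V, (if z ∈ w then walkProb K ν w else 0) ≠ 0 := by
    by_contra hc
    push Not at hc
    simp [hitProb, hc] at h
  have hz : z ∈ w := by by_contra h; simp [h] at hw
  rw [if_pos hz] at hw
  rcases w with _ | ⟨x, w⟩
  · simp at hz
  simp only [walkProb] at hw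
  have h1 : ν x ≠ 0 := left_ne_zero_of_mul hw
  have h2 : pathProb K x w ≠ 0 := right_ne_zero_of_mul hw
  set g : Finset V → Finset V := fun A => idlaUpdate A (x :: w) with hg
  have h3 : pE K x g ≠ 0 := by
    intro h0
    have := ENNReal.le_tsum (f := fun w' => pathProb K x w' *
      (if (fun A => idlaUpdate A (x :: w')) = g then 1 else 0)) w
    rw [if_pos rfl, mul_one] at this
    exact h2 (le_zero_iff.1 (this.trans h0.le))
  have h4 : 0 < pI K ν g := by
    refine lt_of_lt_of_le ?_ (single_le_sum (f := fun x => (ν x).toReal * (pE K x g).toReal)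
      (fun x _ => mul_nonneg ENNReal.toReal_nonneg ENNReal.toReal_nonneg) (mem_univ x))
    exact mul_pos (ENNReal.toReal_pos h1 (nu_ne_top hν x)) (ENNReal.toReal_pos h3 (pE_ne_top hsub x g))
  have h5 : g (univ.erase z) = univ := idla_hit _ z hz
  refine lt_of_lt_of_le h4 ?_
  have := single_le_sum (f := fun g => if g (univ.erase z) = univ then pI K ν g else 0)
    (fun g _ => by split_ifs; exacts [hp.nonneg g, le_rfl]) (mem_univ g)
  rw [if_pos h5] at this
  exact this

end idla
end ARW

namespace ARW
open Finset
set_option linter.unusedSectionVars false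
set_option linter.unusedVariables false

section coupling
variable {V : Type} [Fintype V] [DecidableEq V]

def cf (η : V → Bool) (A : Finset V) : Conf V := fun x =>
  if x ∈ A then (if η x then Site.active 1 else Site.active 0)
  else (if η x then Site.sleeping else Site.empty)

lemma cf_empty (η : V → Bool) : cf η ∅ = embed η := by
  funext x; simp [cf, embed]

lemma cf_add (η : V → Bool) {A : Finset V} {x : V} (h : x ∉ A) :
    addActiveAt (cf η A) x = cf η (insert x A) := by
  funext y
  unfold addActiveAt
  by_cases hy : y = x
  · subst hy
    rw [Function.update_self]
    unfold cf
    rw [if_neg h, if_pos (mem_insert_self _ _)]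
    split_ifs <;> rfl
  · rw [Function.update_of_ne hy]
    simp [cf, mem_insert, hy]

lemma cf_active (η : V → Bool) {A : Finset V} {x : V} (h : x ∈ A) :
    (cf η A x).isActive = true := by
  unfold cf; rw [if_pos h]; split_ifs <;> rfl

lemma diff_zero {k : V → V → ℝ} (hk : NetR k) (d : V → ℝ)
    (h : ∀ x, d x = 0 ∨ d x = ∑ y, k x y * d y) (x : V) : d x = 0 := by
  refine hk.harm_zero d (fun x => ?_) x
  have h1 : |∑ y, k x y * d y| ≤ ∑ y, k x y * |d y| := by
    refine (abs_sum_le_sum_abs _ _).trans (le_of_eq (sum_congr rfl fun y _ => ?_))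
    rw [abs_mul, abs_of_nonneg (hk.nonneg x y)]
  rcases h x with h | h
  · rw [h, abs_zero]
    exact (abs_nonneg _).trans h1
  · conv_lhs => rw [h]
    exact h1

variable {K : V → V → ℝ≥0∞} {lam : ℝ} {ν : V → ℝ≥0∞}

lemma couple (hsub : SubStochastic K) (hnd : NonDegenerate K) (hl : 0 < lam) {u : Conf V → ℝ}
    (hu : Harm (kR K) lam u) (η : V → Bool) (A : Finset V) :
    ∑ x, (ν x).toReal * u (addActiveAt (cf η A) x) = ∑ g, pI K ν g * u (cf η (g A)) := by
  rw [pI_avg]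
  refine sum_congr rfl fun x _ => ?_
  congr 1
  have := diff_zero (kR_net hsub hnd) (fun x => u (addActiveAt (cf η A) x)
    - ∑ g, (pE K x g).toReal * u (cf η (g A))) (fun x => ?_) x
  · linarith
  by_cases h : x ∈ A
  · right
    rw [hu.move hl (cf_active η h), avg_mem hsub x h (fun B => u (cf η B))]
    simp only [mul_sub, sum_sub_distrib]
    ring
  · left
    rw [avg_notMem hsub hnd x h (fun B => u (cf η B)), cf_add η h, sub_self]

lemma all_active {k : V → V → ℝ} (hk : NetR k) (hl : 0 < lam) {u : Conf V → ℝ}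
    (hu : Harm k lam u) (c : Conf V) (hc : ∀ x, (c x).isActive = true) (x : V) :
    u (addActiveAt c x) = u c := by
  have := diff_zero hk (fun x => u (addActiveAt c x) - u c) (fun x => ?_) x
  · linarith
  right
  rw [hu.move hl (hc x)]
  simp only [mul_sub, sum_sub_distrib, sub_mul, ← sum_mul]
  ring

lemma cf_univ {k : V → V → ℝ} (hk : NetR k) (hl : 0 < lam) {u : Conf V → ℝ}
    (hu : Harm k lam u) (η : V → Bool) :
    u (cf η univ) = u (cf (fun _ => false) univ) := by
  have : ∀ Z : Finset V, u (cf (fun x => decide (x ∈ Z)) univ) = u (cf (fun _ => false) univ) := by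
    intro Z
    induction Z using Finset.induction_on with
    | empty => simp
    | insert a Z ha ih =>
      rw [← ih, ← all_active hk hl hu (cf (fun x => decide (x ∈ Z)) univ) (fun x => cf_active _ (mem_univ x)) a]
      congr 1
      funext y
      unfold addActiveAt
      by_cases hy : y = a
      · subst hy
        simp [cf, ha, Site.addActive]
      · simp [cf, hy]
  have h := this (univ.filter fun x => η x = true)
  simpa using h

lemma harm_repr {k : V → V → ℝ} (hk : NetR k) (hl : 0 < lam) {u : Conf V → ℝ}
    (hu : Harm k lam u) (c : Conf V) :
    u c = ∑ σ : V → Bool, u (embed σ) * hS k lam (embed σ) c := by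
  have h1 := hu.sub (Harm.sum univ (fun σ : V → Bool => u (embed σ))
    (fun σ => hS k lam (embed σ)) (fun σ _ => hS_harm hk hl _ (embed_stable σ)))
  have := harm_unique hk hl h1 (csize c + 1) (fun c' hc' _ => ?_) c (Nat.lt_succ_self _)
  · linarith
  obtain ⟨b, rfl⟩ := stable_embed hc'
  rw [sum_eq_single b]
  · rw [hS_stable hk hl _ _ hc']; simp
  · intro b' _ hb
    rw [hS_stable hk hl _ _ hc', if_neg]
    · simp
    · exact fun h => hb (embed_inj h).symm
  · simp

noncomputable def Ht (k : V → V → ℝ) (lam : ℝ) (n : V → ℝ) (ξ : V → Bool) : ℕ → Conf V → ℝ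
  | 0 => hS k lam (embed ξ)
  | t + 1 => fun c => ∑ x, n x * Ht k lam n ξ t (addActiveAt c x)

lemma Ht_harm {k : V → V → ℝ} (hk : NetR k) (hl : 0 < lam) (n : V → ℝ) (ξ : V → Bool) (t : ℕ) :
    Harm k lam (Ht k lam n ξ t) := by
  induction t with
  | zero => exact hS_harm hk hl _ (embed_stable ξ)
  | succ t ih =>
    rw [Ht]
    exact Harm.sum univ n (fun x c => Ht k lam n ξ t (addActiveAt c x)) (fun x _ => ih.add x)

lemma pow_eq (hsub : SubStochastic K) (hnd : NonDegenerate K) (hl : 0 < lam)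
    (hν : IsProbVec ν) (t : ℕ) (η ξ : V → Bool) :
    (arwMatrix K lam ν ^ t) η ξ = Ht (kR K) lam (fun x => (ν x).toReal) ξ t (embed η) := by
  have hk := kR_net hsub hnd
  induction t generalizing η with
  | zero =>
    rw [pow_zero, Ht, hS_stable hk hl _ _ (embed_stable η), Matrix.one_apply]
    by_cases h : η = ξ
    · simp [h]
    · rw [if_neg h, if_neg fun h' => h (embed_inj h')]
  | succ t ih =>
    rw [pow_succ', Matrix.mul_apply]
    simp only [ih, arwMatrix_apply hsub hnd hl (nu_ne_top hν), sum_mul]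
    rw [sum_comm, Ht]
    refine sum_congr rfl fun x _ => ?_
    rw [harm_repr hk hl (Ht_harm hk hl _ ξ t) (addActiveAt (embed η) x), mul_sum]
    exact sum_congr rfl fun σ _ => by ring

lemma row_one (hsub : SubStochastic K) (hnd : NonDegenerate K) (hl : 0 < lam)
    (hν : IsProbVec ν) (η : V → Bool) : ∑ ξ, arwMatrix K lam ν η ξ = 1 := by
  have hk := kR_net hsub hnd
  simp only [arwMatrix_apply hsub hnd hl (nu_ne_top hν)]
  rw [sum_comm, ← nu_sum hν]
  refine sum_congr rfl fun x _ => ?_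
  rw [← mul_sum]
  have := harm_repr hk hl (Harm.const (k := kR K) hl 1) (addActiveAt (embed η) x)
  simp only [one_mul] at this
  rw [← this, mul_one]

noncomputable def mu (K : V → V → ℝ≥0∞) (lam : ℝ) (ξ : V → Bool) : ℝ :=
  hS (kR K) lam (embed ξ) (cf (fun _ => false) univ)

lemma hS_nonneg {k : V → V → ℝ} (hk : NetR k) (hl : 0 < lam) (ξ : V → Bool) (c : Conf V) :
    0 ≤ hS k lam (embed ξ) c :=
  ge_of_tendsto' (hS_tendsto hk hl _ (embed_stable ξ) c) fun n => aN_nonneg hk hl _ n c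

lemma mu_sum (hsub : SubStochastic K) (hnd : NonDegenerate K) (hl : 0 < lam) :
    ∑ ξ, mu K lam ξ = 1 := by
  have := harm_repr (kR_net hsub hnd) hl (Harm.const (k := kR K) hl 1) (cf (fun _ => false) univ)
  simp only [one_mul] at this
  exact this.symm

lemma avg_lin {p : (Finset V → Finset V) → ℝ} (hp : Good p) (t : ℕ) (A : Finset V) (m : ℝ) :
    ∑ g, p g * ((1 - qd p t (g A)) * m) = (1 - qd p (t+1) A) * m := by
  rw [qd]
  have : ∀ g, p g * ((1 - qd p t (g A)) * m) = p g * m - (p g * qd p t (g A)) * m :=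
    fun g => by ring
  simp only [this, sum_sub_distrib]
  rw [hp.avg_const, ← sum_mul]; ring

lemma lower (hsub : SubStochastic K) (hnd : NonDegenerate K) (hl : 0 < lam)
    (hν : IsProbVec ν) (t : ℕ) (η ξ : V → Bool) (A : Finset V) :
    (1 - qd (pI K ν) t A) * mu K lam ξ
      ≤ Ht (kR K) lam (fun x => (ν x).toReal) ξ t (cf η A) := by
  have hk := kR_net hsub hnd
  have hp := pI_good hsub hnd hν
  induction t generalizing A with
  | zero =>
    rw [qd, Ht]
    split_ifs with h
    · rw [h, cf_univ hk hl (hS_harm hk hl _ (embed_stable ξ)) η, mu]; simp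
    · simpa using hS_nonneg hk hl ξ _
  | succ t ih =>
    simp only [Ht]
    rw [couple hsub hnd hl (Ht_harm hk hl _ ξ t), ← avg_lin hp]
    exact hp.avg_le fun g _ => ih (g A)

lemma full_zero {k : V → V → ℝ} (hk : NetR k) (hl : 0 < lam) (c : Conf V)
    (h : csize c < Fintype.card V) : hS k lam (embed fun _ => true) c = 0 := by
  refine harm_unique hk hl (hS_harm hk hl _ (embed_stable _)) (Fintype.card V) ?_ c h
  intro c' h1 h2
  rw [hS_stable hk hl _ _ h1, if_neg]
  rintro rfl
  simp [csize, embed, Site.size] at h2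

lemma csize_cf (A : Finset V) : csize (cf (fun _ => false) A) = A.card := by
  unfold csize cf
  rw [card_eq_sum_ones, ← sum_subset (subset_univ A)]
  · exact sum_congr rfl fun x hx => by simp [hx, Site.size]
  · intro x _ hx; simp [hx, Site.size]

lemma upper (hsub : SubStochastic K) (hnd : NonDegenerate K) (hl : 0 < lam)
    (hν : IsProbVec ν) (t : ℕ) (A : Finset V) :
    Ht (kR K) lam (fun x => (ν x).toReal) (fun _ => true) t (cf (fun _ => false) A)
     = (1 - qd (pI K ν) t A) * mu K lam (fun _ => true) := by
  have hk := kR_net hsub hnd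
  have hp := pI_good hsub hnd hν
  induction t generalizing A with
  | zero =>
    rw [qd, Ht]
    split_ifs with h
    · rw [h, mu]; simp
    · rw [full_zero hk hl]
      · simp
      · rw [csize_cf]
        exact (card_lt_iff_ne_univ A).2 h
  | succ t ih =>
    simp only [Ht]
    rw [couple hsub hnd hl (Ht_harm hk hl _ _ t), ← avg_lin hp]
    exact sum_congr rfl fun g _ => by rw [ih (g A)]

end coupling
end ARW

namespace ARW

/-- **Theorem 2 (Mixing window).**  For any `ε ∈ (0,1/2)`, the `ARW(K,lam,ν)` chain
satisfies `t_sep(ε) − t_sep(1−ε) ≤ √(8 t_rel t_sep / ε)`. -/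
theorem arw_mixing_window
    {V : Type} [Fintype V] [DecidableEq V] [Nonempty V]
    (K : V → V → ℝ≥0∞) (hsub : SubStochastic K) (hnd : NonDegenerate K)
    (ν : V → ℝ≥0∞) (hν : IsProbVec ν) (hadm : Admissible K ν)
    (lam : ℝ) (hlam : 0 < lam)
    (π : (V → Bool) → ℝ) (hπ : IsStationary (arwMatrix K lam ν) π)
    (ε : ℝ) (hε0 : 0 < ε) (hε1 : ε < 1 / 2) :
    (sepMix (arwMatrix K lam ν) π ε : ℝ) - (sepMix (arwMatrix K lam ν) π (1 - ε) : ℝ)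
      ≤ Real.sqrt (8 * relTime (arwMatrix K lam ν)
          * (sepMix (arwMatrix K lam ν) π (1 / 2) : ℝ) / ε) := by
  set P := arwMatrix K lam ν with hP
  have hle : ∀ t η ξ, 1 - (P ^ t) η ξ / π ξ ≤ sepDist P π t := by
    intro t η ξ
    refine le_trans ?_ (le_ciSup (f := fun η => ⨆ ξ, (1 - (P ^ t) η ξ / π ξ))
      (Set.finite_range _).bddAbove η)
    exact le_ciSup (f := fun ξ => (1 - (P ^ t) η ξ / π ξ)) (Set.finite_range _).bddAbove ξ
  by_cases hpos : ∀ ξ, π ξ ≠ 0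
  swap
  · push Not at hpos
    obtain ⟨ξ, hξ⟩ := hpos
    have h1 : ∀ t, 1 ≤ sepDist P π t := fun t => by
      have := hle t ξ ξ
      simpa [hξ] using this
    have h2 : sepMix P π ε = 0 := by
      unfold sepMix
      rw [show {t : ℕ | sepDist P π t ≤ ε} = ∅ from ?_, Nat.sInf_empty]
      ext t
      simp only [Set.mem_ofPred_eq, Set.mem_empty_iff_false, iff_false]
      linarith [h1 t]
    rw [h2]
    have : (0:ℝ) ≤ sepMix P π (1 - ε) := Nat.cast_nonneg _
    have := Real.sqrt_nonneg (8 * relTime P * (sepMix P π (1 / 2) : ℝ) / ε)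
    push_cast
    linarith
  have hpos : ∀ ξ, 0 < π ξ := fun ξ => lt_of_le_of_ne (hπ.1 ξ) (Ne.symm (hpos ξ))
  have hp := pI_good hsub hnd hν
  set p := pI K ν with hpdef
  have hrow : ∀ s, ∑ r, P s r = 1 := row_one hsub hnd hlam hν
  obtain ⟨z0, -, hz0⟩ := Finset.exists_min_image Finset.univ (pz p) Finset.univ_nonempty
  have hz0p : 0 < pz p z0 := pz_pos hsub hnd hν hadm z0
  have hqd : Tendsto (fun t => qd p t ∅) atTop (nhds 0) := by
    refine qd_tendsto hp (c := (pz p z0)⁻¹) (inv_nonneg.2 hz0p.le) (fun z => ?_) ∅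
    rw [← div_eq_mul_inv, le_div_iff₀ hz0p, one_mul]
    exact hz0 z (Finset.mem_univ z)
  have hlowmu : ∀ t η ξ, (1 - qd p t ∅) * mu K lam ξ ≤ (P ^ t) η ξ := by
    intro t η ξ
    rw [hP, pow_eq hsub hnd hlam hν, ← cf_empty]
    exact lower hsub hnd hlam hν t η ξ ∅
  have hpiP : ∀ t ξ, ∑ η, π η * (P ^ t) η ξ = π ξ := by
    intro t
    induction t with
    | zero => intro ξ; simp [Matrix.one_apply]
    | succ t ih =>
      intro ξ
      simp only [pow_succ, Matrix.mul_apply, Finset.mul_sum, ← mul_assoc]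
      rw [Finset.sum_comm]
      simp only [← Finset.sum_mul, ih]
      exact hπ.2.2 ξ
  have hge : ∀ ξ, mu K lam ξ ≤ π ξ := by
    intro ξ
    have h1 : ∀ t, (1 - qd p t ∅) * mu K lam ξ ≤ π ξ := by
      intro t
      rw [← hpiP t ξ]
      calc (1 - qd p t ∅) * mu K lam ξ = ∑ η, π η * ((1 - qd p t ∅) * mu K lam ξ) := by
            rw [← Finset.sum_mul, hπ.2.1, one_mul]
        _ ≤ _ := Finset.sum_le_sum fun η _ => mul_le_mul_of_nonneg_left (hlowmu t η ξ) (hπ.1 η)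
    have h3 := (hqd.const_sub 1).mul_const (mu K lam ξ)
    rw [sub_zero, one_mul] at h3
    exact le_of_tendsto' h3 h1
  have hmu : ∀ ξ, mu K lam ξ = π ξ := by
    intro ξ
    have := (Finset.sum_eq_sum_iff_of_le (fun ξ _ => hge ξ)).1
      ((mu_sum hsub hnd hlam).trans hπ.2.1.symm)
    exact this ξ (Finset.mem_univ ξ)
  have hlow : ∀ t η ξ, (1 - qd p t ∅) * π ξ ≤ (P ^ t) η ξ := by
    intro t η ξ; rw [← hmu]; exact hlowmu t η ξ
  have htop : ∀ t, (P ^ t) (fun _ => false) (fun _ => true) = (1 - qd p t ∅) * π (fun _ => true) := by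
    intro t
    rw [hP, pow_eq hsub hnd hlam hν, ← cf_empty, upper hsub hnd hlam hν, hmu]
  have hsep : ∀ t, sepDist P π t = qd p t ∅ := by
    intro t
    apply le_antisymm
    · refine ciSup_le fun η => ciSup_le fun ξ => ?_
      have := (le_div_iff₀ (hpos ξ)).2 (hlow t η ξ)
      linarith
    · have := hle t (fun _ => false) (fun _ => true)
      rw [htop, mul_div_cancel_right₀ _ (hpos _).ne'] at this
      linarith
  have hmem : ∀ δ, 0 < δ → qd p (sepMix P π δ) ∅ ≤ δ := by
    intro δ hδ
    have hne : {t : ℕ | sepDist P π t ≤ δ}.Nonempty := by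
      obtain ⟨t, ht⟩ := (hqd.eventually (gt_mem_nhds hδ)).exists
      exact ⟨t, by rw [Set.mem_ofPred_eq, hsep]; exact ht.le⟩
    have := Nat.sInf_mem hne
    rw [Set.mem_ofPred_eq, hsep] at this
    exact this
  obtain ⟨ρ, hρ, h1, h2⟩ := spectral P π hrow hπ (fun t => qd p t ∅) hqd hlow
    (fun _ => false) (fun _ => true) (hpos _) (1 - pz p z0) (by linarith [pz_le_one hp z0])
    (fun t => by
      rw [htop, ← qd_erase hp]
      have := mul_le_mul_of_nonneg_right (qd_anti hp t (Finset.empty_subset (Finset.univ.erase z0)))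
        (hpos (fun _ => true)).le
      linarith)
  have hc : ∀ z, 1 ≤ pz p z * relTime P := by
    intro z
    have := hz0 z (Finset.mem_univ z)
    rw [hρ, ← div_eq_mul_inv, le_div_iff₀ (by linarith)]
    linarith
  refine window hp (c := relTime P) (by rw [hρ]; exact inv_nonneg.2 (by linarith)) hc
    (hmem _ (by norm_num)) hε0 (hmem _ (by linarith)) ?_
  rcases Nat.eq_zero_or_pos (sepMix P π ε) with h | h
  · exact Or.inl h
  · right
    have := Nat.notMem_of_lt_sInf (m := sepMix P π ε - 1) (s := {t : ℕ | sepDist P π t ≤ ε})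
      (by unfold sepMix at h ⊢; omega)
    rw [Set.mem_ofPred_eq, hsep] at this
    exact not_le.1 this

end ARW
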